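/- arXiv:1705.07960 — 2 statements merged into one kernel-verified Lean document; each statement's English description precedes it below -/
import Mathlib

section
/- (Adiprasito–Huh–Katz, Poincaré duality) Let M be a loopless matroid of rank d+1 on a finite ground set E. For every 0 ≤ k ≤ d, the multiplication map A^k(M) × A^{d−k}(M) → A^d(M), followed by the degree isomorphism deg : A^d(M) ≅ ℤ, is a perfect pairing; that is, the induced map A^k(M) → Hom_ℤ(A^{d−k}(M), ℤ) is an isomorphism of abelian groups. -/
structure FinMatroid (E : Type*) [Fintype E] [DecidableEq E] where
  Indep : Finset E → Prop
  indep_empty : Indep ∅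
  indep_subset : ∀ ⦃I J : Finset E⦄, Indep J → I ⊆ J → Indep I
  indep_exchange : ∀ ⦃I J : Finset E⦄, Indep I → Indep J → I.card < J.card →
    ∃ e ∈ J, e ∉ I ∧ Indep (insert e I)

namespace FinMatroid

variable {E : Type*} [Fintype E] [DecidableEq E]

open Classical in
noncomputable def rank (M : FinMatroid E) (A : Finset E) : ℕ :=
  (A.powerset.filter fun I => M.Indep I).sup Finset.card

noncomputable def rk (M : FinMatroid E) : ℕ := M.rank Finset.univ

noncomputable def closure (M : FinMatroid E) (A : Finset E) : Finset E :=
  Finset.univ.filter fun x => M.rank (insert x A) = M.rank A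

def IsFlat (M : FinMatroid E) (F : Finset E) : Prop := M.closure F = F

def Loopless (M : FinMatroid E) : Prop := M.closure ∅ = ∅

/-- The type of nonempty proper flats of `M`. -/
def ProperFlat (M : FinMatroid E) : Type _ :=
  {F : Finset E // M.IsFlat F ∧ F ≠ ∅ ∧ F ≠ Finset.univ}

instance (M : FinMatroid E) : Finite (ProperFlat M) := Subtype.finite

noncomputable instance (M : FinMatroid E) : Fintype (ProperFlat M) := Fintype.ofFinite _

variable (R : Type*) [CommRing R]

/-- The ideal of relations defining the Chow ring of a matroid: the linear relations (CH1)
`Σ_{F ∋ a} x_F = Σ_{F ∋ b} x_F` for `a, b ∈ E`, and the quadratic relations (CH2)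
`x_F · x_{F'} = 0` for incomparable proper flats `F, F'`. -/
noncomputable def chowIdeal (M : FinMatroid E) : Ideal (MvPolynomial (ProperFlat M) R) :=
  Ideal.span
    ((Set.range fun ab : E × E =>
        (∑ F : ProperFlat M, if ab.1 ∈ F.1 then MvPolynomial.X F else 0) -
        (∑ F : ProperFlat M, if ab.2 ∈ F.1 then MvPolynomial.X F else 0)) ∪
     {p | ∃ F F' : ProperFlat M, ¬F.1 ⊆ F'.1 ∧ ¬F'.1 ⊆ F.1 ∧
        p = MvPolynomial.X F * MvPolynomial.X F'})

/-- The Chow ring `A*(M)` (with coefficients in `R`). -/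
abbrev ChowRing (M : FinMatroid E) := MvPolynomial (ProperFlat M) R ⧸ chowIdeal R M

/-- The quotient map from the polynomial ring onto the Chow ring. -/
noncomputable def chowMk (M : FinMatroid E) :
    MvPolynomial (ProperFlat M) R →ₐ[R] ChowRing R M :=
  Ideal.Quotient.mkₐ R (chowIdeal R M)

/-- The degree-`k` graded piece `A^k(M)` of the Chow ring: the image of the homogeneous
degree-`k` polynomials. -/
noncomputable def piece (M : FinMatroid E) (k : ℕ) : Submodule R (ChowRing R M) :=
  (MvPolynomial.homogeneousSubmodule (ProperFlat M) R k).map (chowMk R M).toLinearMap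

lemma mk_mem_piece {M : FinMatroid E} {p : MvPolynomial (ProperFlat M) R} {k : ℕ}
    (hp : p.IsHomogeneous k) : chowMk R M p ∈ piece R M k :=
  ⟨p, (MvPolynomial.mem_homogeneousSubmodule _ _).2 hp, rfl⟩

lemma mul_mem_piece {M : FinMatroid E} {k l : ℕ} {a b : ChowRing R M}
    (ha : a ∈ piece R M k) (hb : b ∈ piece R M l) : a * b ∈ piece R M (k + l) := by
  obtain ⟨p, hp, rfl⟩ := ha
  obtain ⟨q, hq, rfl⟩ := hb
  refine ⟨p * q, ?_, by simp⟩
  simp only [SetLike.mem_coe, MvPolynomial.mem_homogeneousSubmodule] at hp hq ⊢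
  exact hp.mul hq

lemma pow_mem_piece {M : FinMatroid E} {a : ChowRing R M} (ha : a ∈ piece R M 1) (m : ℕ) :
    a ^ m ∈ piece R M m := by
  induction m with
  | zero =>
      refine ⟨1, ?_, by simp⟩
      simp only [SetLike.mem_coe, MvPolynomial.mem_homogeneousSubmodule]
      simpa using MvPolynomial.isHomogeneous_one (ProperFlat M) R
  | succ n ih =>
      have h := mul_mem_piece R ih ha
      simpa [pow_succ] using h

/-- The image in the Chow ring of the monomial attached to a flag of `d` proper flats lies in
the degree-`d` graded piece. -/
lemma flagMonomial_mem (M : FinMatroid E) (d : ℕ) (flag : Fin d → ProperFlat M) :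
    chowMk R M (∏ i, MvPolynomial.X (flag i)) ∈ piece R M d := by
  refine mk_mem_piece R ?_
  have h := MvPolynomial.IsHomogeneous.prod (R := R) Finset.univ
    (fun i => MvPolynomial.X (flag i)) (fun _ => 1)
    (fun i _ => MvPolynomial.isHomogeneous_X R (flag i))
  simpa using h

/-- Homogeneity (of degree one) of an `R`-linear combination of the variables. -/
lemma isHomogeneous_comb (M : FinMatroid E) (P : ProperFlat M → Prop) [DecidablePred P]
    (c : ProperFlat M → R) :
    MvPolynomial.IsHomogeneous
      (∑ F : ProperFlat M, if P F then MvPolynomial.C (c F) * MvPolynomial.X F else 0) 1 := by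
  refine MvPolynomial.IsHomogeneous.sum _ _ _ (fun F _ => ?_)
  by_cases h : P F
  · simp only [h, if_true]
    simpa using (MvPolynomial.isHomogeneous_C (ProperFlat M) (c F)).mul
      (MvPolynomial.isHomogeneous_X R F)
  · simp [h, MvPolynomial.isHomogeneous_zero]

end FinMatroid

set_option linter.unusedSectionVars false

namespace FinMatroid

section MatroidFacts

variable {E : Type*} [Fintype E] [DecidableEq E] (M : FinMatroid E)

lemma card_le_rank {I A : Finset E} (hI : M.Indep I) (hIA : I ⊆ A) : I.card ≤ M.rank A := by
  classical
  unfold rank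
  exact Finset.le_sup (f := Finset.card) (by simp [hI, hIA])

lemma exists_base (A : Finset E) : ∃ I, M.Indep I ∧ I ⊆ A ∧ I.card = M.rank A := by
  classical
  have hne : (A.powerset.filter fun I => M.Indep I).Nonempty :=
    ⟨∅, by simp [M.indep_empty]⟩
  obtain ⟨I, hI, h⟩ := Finset.exists_mem_eq_sup _ hne Finset.card
  simp only [Finset.mem_filter, Finset.mem_powerset] at hI
  refine ⟨I, hI.2, hI.1, ?_⟩
  unfold rank
  rw [h]

lemma rank_mono {A B : Finset E} (h : A ⊆ B) : M.rank A ≤ M.rank B := by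
  obtain ⟨I, hI, hIA, hc⟩ := M.exists_base A
  rw [← hc]
  exact M.card_le_rank hI (hIA.trans h)

lemma rank_empty : M.rank ∅ = 0 := by
  obtain ⟨I, hI, hIA, hc⟩ := M.exists_base ∅
  rw [← hc, Finset.subset_empty.1 hIA, Finset.card_empty]

lemma rank_insert_le (x : E) (A : Finset E) : M.rank (insert x A) ≤ M.rank A + 1 := by
  obtain ⟨I, hI, hIA, hc⟩ := M.exists_base (insert x A)
  have h1 : (I.erase x).card ≤ M.rank A :=
    M.card_le_rank (M.indep_subset hI (Finset.erase_subset _ _))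
      (fun z hz => by
        have h0 := hIA (Finset.mem_of_mem_erase hz)
        rcases Finset.mem_insert.1 h0 with h | h
        · exact absurd h (Finset.ne_of_mem_erase hz)
        · exact h)
  have h2 := Finset.pred_card_le_card_erase (s := I) (a := x)
  omega

lemma exists_extend {I A : Finset E} (hI : M.Indep I) (hIA : I ⊆ A) :
    ∃ J, M.Indep J ∧ I ⊆ J ∧ J ⊆ A ∧ J.card = M.rank A := by
  obtain ⟨K, hK, hKA, hc⟩ := M.exists_base A
  by_cases h : I.card < K.card
  · obtain ⟨e, heK, heI, hins⟩ := M.indep_exchange hI hK h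
    have hsub : insert e I ⊆ A := Finset.insert_subset (hKA heK) hIA
    have hcard : (insert e I).card = I.card + 1 := Finset.card_insert_of_notMem heI
    obtain ⟨J, h1, h2, h3, h4⟩ := exists_extend hins hsub
    exact ⟨J, h1, (Finset.subset_insert _ _).trans h2, h3, h4⟩
  · have := M.card_le_rank hI hIA
    exact ⟨I, hI, subset_rfl, hIA, by omega⟩
termination_by M.rank A - I.card
decreasing_by
  have := M.card_le_rank hins hsub
  omega

lemma mem_closure {x : E} {A : Finset E} :
    x ∈ M.closure A ↔ M.rank (insert x A) = M.rank A := by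
  simp [closure]

lemma subset_closure (A : Finset E) : A ⊆ M.closure A := by
  intro x hx
  rw [mem_closure, Finset.insert_eq_of_mem hx]

lemma closure_mono {A B : Finset E} (h : A ⊆ B) : M.closure A ⊆ M.closure B := by
  intro x hx
  rw [mem_closure] at hx ⊢
  obtain ⟨I, hI, hIA, hc⟩ := M.exists_base A
  obtain ⟨J, hJ, hIJ, hJB, hJc⟩ := M.exists_extend hI (hIA.trans h)
  refine le_antisymm ?_ (M.rank_mono (Finset.subset_insert _ _))
  by_contra hlt
  push Not at hlt
  obtain ⟨K, hK, hKB, hKc⟩ := M.exists_base (insert x B)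
  obtain ⟨e, heK, heJ, hins⟩ := M.indep_exchange hJ hK (by omega)
  rcases Finset.mem_insert.1 (hKB heK) with rfl | heB
  · have h1 : M.Indep (insert e I) := M.indep_subset hins (Finset.insert_subset_insert _ hIJ)
    have h2 := M.card_le_rank h1 (Finset.insert_subset_insert e hIA)
    rw [Finset.card_insert_of_notMem (fun h => heJ (hIJ h))] at h2
    omega
  · have h2 := M.card_le_rank hins (Finset.insert_subset heB hJB)
    rw [Finset.card_insert_of_notMem heJ] at h2
    omega

lemma rank_closure (A : Finset E) : M.rank (M.closure A) = M.rank A := by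
  refine le_antisymm ?_ (M.rank_mono (M.subset_closure A))
  by_contra hlt
  push Not at hlt
  obtain ⟨I, hI, hIA, hc⟩ := M.exists_base A
  obtain ⟨K, hK, hKB, hKc⟩ := M.exists_base (M.closure A)
  obtain ⟨e, heK, heI, hins⟩ := M.indep_exchange hI hK (by omega)
  have h1 := M.mem_closure.1 (hKB heK)
  have h2 := M.card_le_rank hins (Finset.insert_subset_insert e hIA)
  rw [Finset.card_insert_of_notMem heI] at h2
  omega

lemma isFlat_closure (A : Finset E) : M.IsFlat (M.closure A) := by
  refine Finset.Subset.antisymm ?_ (M.subset_closure _)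
  intro x hx
  rw [mem_closure, rank_closure] at hx
  rw [mem_closure]
  refine le_antisymm ?_ (M.rank_mono (Finset.subset_insert _ _))
  rw [← hx]
  exact M.rank_mono (Finset.insert_subset_insert _ (M.subset_closure A))

lemma closure_subset {A F : Finset E} (hF : M.IsFlat F) (h : A ⊆ F) : M.closure A ⊆ F := by
  have := M.closure_mono h
  rwa [hF] at this

lemma isFlat_univ : M.IsFlat Finset.univ :=
  Finset.Subset.antisymm (Finset.subset_univ _) (M.subset_closure _)

lemma rank_lt_of_notMem {F : Finset E} (hF : M.IsFlat F) {a : E} (ha : a ∉ F) :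
    M.rank (insert a F) = M.rank F + 1 := by
  have h1 : M.rank (insert a F) ≠ M.rank F := fun h => ha (by rw [← hF]; exact M.mem_closure.2 h)
  have h2 := M.rank_insert_le a F
  have h3 := M.rank_mono (Finset.subset_insert a F)
  omega

lemma rank_lt {F G : Finset E} (hF : M.IsFlat F) (h : F ⊂ G) : M.rank F < M.rank G := by
  obtain ⟨a, haG, haF⟩ := Finset.exists_of_ssubset h
  have h1 := M.rank_lt_of_notMem hF haF
  have h2 := M.rank_mono (Finset.insert_subset haG h.1)
  omega

lemma rank_lt_rk {F : Finset E} (hF : M.IsFlat F) (h : F ≠ Finset.univ) : M.rank F < M.rk :=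
  M.rank_lt hF (Finset.ssubset_univ_iff.2 h)

lemma rank_le_rk (F : Finset E) : M.rank F ≤ M.rk := M.rank_mono (Finset.subset_univ _)

/-- Existence of a flat covered by `G` above `F`. -/
lemma exists_coatom {F G : Finset E} (hF : M.IsFlat F) (hG : M.IsFlat G) (h : F ⊂ G) :
    ∃ G' a, M.IsFlat G' ∧ F ⊆ G' ∧ a ∉ G' ∧ M.closure (insert a G') = G ∧
      M.rank G = M.rank G' + 1 := by
  obtain ⟨a, haG, haF⟩ := Finset.exists_of_ssubset h
  have hsub : M.closure (insert a F) ⊆ G := M.closure_subset hG (Finset.insert_subset haG h.1)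
  have hr := M.rank_lt_of_notMem hF haF
  rw [← M.rank_closure (insert a F)] at hr
  by_cases heq : M.closure (insert a F) = G
  · exact ⟨F, a, hF, subset_rfl, haF, heq, by rw [← heq, hr]⟩
  · have hlt := M.rank_lt hF h
    obtain ⟨G', b, h1, h2, h3⟩ := exists_coatom (M.isFlat_closure (insert a F)) hG
      (Finset.ssubset_iff_subset_ne.2 ⟨hsub, heq⟩)
    exact ⟨G', b, h1, ((Finset.subset_insert _ _).trans (M.subset_closure _)).trans h2, h3⟩
termination_by M.rank G - M.rank F
decreasing_by
  have h0 := M.rank_closure (insert a F)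
  have h1 := M.rank_lt_of_notMem hF haF
  exact Nat.sub_lt_sub_left hlt (by omega)

end MatroidFacts

section Straightening

variable {E : Type*} [Fintype E] [DecidableEq E]
variable {A : Type*} [CommRing A]

/-- A family of ring elements indexed by subsets satisfying the relations of the Chow ring, in
the presentation with an extra variable for the ground set, and value `1` at the empty set. -/
structure ChowData (M : FinMatroid E) (y : Finset E → A) : Prop where
  lin : ∀ a, ∑ H with a ∈ H, y H = 0
  inc : ∀ F G, ¬F ⊆ G → ¬G ⊆ F → y F * y G = 0
  flat : ∀ F, ¬M.IsFlat F → y F = 0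

/-- Sum of the variables above `G`. -/
def hsum (y : Finset E → A) (G : Finset E) : A := ∑ H with G ⊆ H, y H

/-- The monomial of a multiset. -/
def mono (y : Finset E → A) (s : Multiset (Finset E)) : A := (s.map y).prod

variable {M : FinMatroid E} {y : Finset E → A}

lemma mono_add (s t : Multiset (Finset E)) : mono y (s + t) = mono y s * mono y t := by
  simp [mono]

lemma mono_cons (G : Finset E) (t : Multiset (Finset E)) :
    mono y (G ::ₘ t) = y G * mono y t := by
  simp [mono]

lemma mono_replicate (n : ℕ) (G : Finset E) : mono y (Multiset.replicate n G) = y G ^ n := by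
  simp [mono]

lemma mono_zero : mono y 0 = 1 := by
  simp [mono]

lemma ChowData.mul_hsum (hy : ChowData M y) {G' G H : Finset E} {a : E}
    (hG : M.closure (insert a G') = G) (hH : G' ⊆ H) (ha : a ∉ H) : y H * hsum y G = 0 := by
  have h0 : y H * ∑ K with a ∈ K, y K = 0 := by rw [hy.lin, mul_zero]
  rw [← h0, hsum, Finset.mul_sum, Finset.mul_sum, Finset.sum_filter, Finset.sum_filter]
  refine Finset.sum_congr rfl fun K _ => ?_
  have haG : insert a G' ⊆ G := by rw [← hG]; exact M.subset_closure _
  by_cases hGK : G ⊆ K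
  · rw [if_pos hGK, if_pos (hGK (haG (Finset.mem_insert_self _ _)))]
  · rw [if_neg hGK]
    by_cases haK : a ∈ K
    · rw [if_pos haK]
      by_cases hK : M.IsFlat K
      · symm
        apply hy.inc
        · intro hHK
          apply hGK
          rw [← hG]
          exact M.closure_subset hK (Finset.insert_subset haK (hH.trans hHK))
        · exact fun h => ha (h haK)
      · rw [hy.flat K hK, mul_zero]
    · rw [if_neg haK]

lemma ChowData.hsum_mul_hsum (hy : ChowData M y) {G' G : Finset E} {a : E}
    (hG : M.closure (insert a G') = G) : hsum y G' * hsum y G = hsum y G * hsum y G := by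
  have haG : insert a G' ⊆ G := by rw [← hG]; exact M.subset_closure _
  conv_lhs => rw [hsum, Finset.sum_mul]
  conv_rhs => enter [1]; rw [hsum]
  rw [Finset.sum_mul]
  symm
  refine Finset.sum_subset ?_ ?_
  · intro K
    simp only [Finset.mem_filter, Finset.mem_univ, true_and]
    exact fun h => ((Finset.subset_insert _ _).trans haG).trans h
  · intro K
    simp only [Finset.mem_filter, Finset.mem_univ, true_and]
    intro h1 h2
    by_cases hK : M.IsFlat K
    · refine hy.mul_hsum hG h1 fun haK => h2 ?_
      rw [← hG]
      exact M.closure_subset hK (Finset.insert_subset haK h1)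
    · rw [hy.flat K hK, zero_mul]

lemma ChowData.hsum_pow_mul (hy : ChowData M y) {G' G : Finset E} {a : E}
    (hG : M.closure (insert a G') = G) (n : ℕ) :
    hsum y G ^ (n + 1) = hsum y G' ^ n * hsum y G := by
  induction n with
  | zero => simp
  | succ n ih =>
    rw [pow_succ, ih, pow_succ, mul_assoc, mul_assoc, hy.hsum_mul_hsum hG]

lemma ChowData.mul_hsum_pow (hy : ChowData M y) {F : Finset E} (hF : M.IsFlat F) (n : ℕ) :
    ∀ G, M.IsFlat G → F ⊂ G → M.rank G = M.rank F + n + 1 → y F * hsum y G ^ (n + 1) = 0 := by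
  induction n with
  | zero =>
    intro G hG hFG hr
    obtain ⟨G', a, h1, h2, h3, h4, h5⟩ := M.exists_coatom hF hG hFG
    have hFG' : F = G' := by
      by_contra hne
      have := M.rank_lt hF (Finset.ssubset_iff_subset_ne.2 ⟨h2, hne⟩)
      omega
    subst hFG'
    simpa using hy.mul_hsum h4 subset_rfl h3
  | succ n ih =>
    intro G hG hFG hr
    obtain ⟨G', a, h1, h2, h3, h4, h5⟩ := M.exists_coatom hF hG hFG
    have hne : F ≠ G' := by
      rintro rfl
      omega
    rw [hy.hsum_pow_mul h4, ← mul_assoc,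
      ih G' h1 (Finset.ssubset_iff_subset_ne.2 ⟨h2, hne⟩) (by omega), zero_mul]

/-- The multiset of a list of flats with multiplicities, together with `e` copies of the ground
set. -/
def ms : List (Finset E × ℕ) → ℕ → Multiset (Finset E)
  | [], e => Multiset.replicate e Finset.univ
  | p :: l, e => Multiset.replicate p.2 p.1 + ms l e

/-- The condition that a monomial is a basis monomial relative to the flat `F`. -/
def Bas (M : FinMatroid E) : Finset E → List (Finset E × ℕ) → ℕ → Prop
  | F, [], e => e ≤ M.rk - 1 - M.rank F
  | F, p :: l, e => M.IsFlat p.1 ∧ F ⊂ p.1 ∧ p.1 ≠ Finset.univ ∧ 1 ≤ p.2 ∧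
      p.2 + M.rank F < M.rank p.1 ∧ Bas M p.1 l e

lemma Bas.mem_ms {l : List (Finset E × ℕ)} : ∀ {F : Finset E} {e : ℕ}, F ≠ Finset.univ →
    Bas M F l e → ∀ G ∈ ms l e, M.IsFlat G ∧ F ⊂ G := by
  induction l with
  | nil =>
    intro F e hF h G hG
    rw [ms, Multiset.mem_replicate] at hG
    rw [hG.2]
    exact ⟨M.isFlat_univ, Finset.ssubset_univ_iff.2 hF⟩
  | cons p l ih =>
    intro F e hF h G hG
    obtain ⟨h1, h2, h3, h4, h5, h6⟩ := h
    rw [ms, Multiset.mem_add, Multiset.mem_replicate] at hG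
    rcases hG with hG | hG
    · rw [hG.2]; exact ⟨h1, h2⟩
    · obtain ⟨h7, h8⟩ := ih h3 h6 G hG
      exact ⟨h7, h2.trans h8⟩

lemma Bas.card_lt {l : List (Finset E × ℕ)} : ∀ {F : Finset E} {e : ℕ}, M.IsFlat F →
    F ≠ Finset.univ → Bas M F l e → (ms l e).card + M.rank F < M.rk := by
  induction l with
  | nil =>
    intro F e hF hF' h
    have := M.rank_lt_rk hF hF'
    simp only [Bas] at h
    simp only [ms, Multiset.card_replicate]
    omega
  | cons p l ih =>
    intro F e hF hF' h
    obtain ⟨h1, h2, h3, h4, h5, h6⟩ := h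
    have := ih h1 h3 h6
    simp only [ms, Multiset.card_add, Multiset.card_replicate]
    omega

/-- The span of the basis monomials relative to `F` of degree `n`. -/
def basSpan (M : FinMatroid E) (y : Finset E → A) (F : Finset E) (n : ℕ) : Submodule ℤ A :=
  Submodule.span ℤ {x | ∃ l e, Bas M F l e ∧ (ms l e).card = n ∧ x = y F * mono y (ms l e)}

/-- Monomials of degree `m` strictly above `G`. -/
def upSet (M : FinMatroid E) (y : Finset E → A) (G : Finset E) (m : ℕ) : Set A :=
  {x | ∃ w : Multiset (Finset E), w.card = m ∧ (∀ K ∈ w, M.IsFlat K ∧ G ⊂ K) ∧ x = mono y w}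

lemma mul_mem_of_span {T : Set A} {W : Submodule ℤ A} {c x : A}
    (hx : x ∈ Submodule.span ℤ T) (h : ∀ t ∈ T, c * t ∈ W) : c * x ∈ W := by
  have : Submodule.span ℤ T ≤ W.comap (LinearMap.mulLeft ℤ c) := by
    rw [Submodule.span_le]
    intro t ht
    exact h t ht
  exact this hx

lemma ChowData.sum_pow_mem (hy : ChowData M y) (G : Finset E) (m : ℕ) :
    (∑ H with G ⊂ H, y H) ^ m ∈ Submodule.span ℤ (upSet M y G m) := by
  induction m with
  | zero =>
    refine Submodule.subset_span ⟨0, rfl, by simp, by simp [mono]⟩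
  | succ m ih =>
    rw [pow_succ, Finset.mul_sum]
    refine Submodule.sum_mem _ fun H hH => ?_
    simp only [Finset.mem_filter, Finset.mem_univ, true_and] at hH
    by_cases hf : M.IsFlat H
    · rw [mul_comm]
      refine mul_mem_of_span ih ?_
      rintro t ⟨w, h1, h2, rfl⟩
      refine Submodule.subset_span ⟨H ::ₘ w, by simp [h1], ?_, by rw [mono_cons]⟩
      intro K hK
      rcases Multiset.mem_cons.1 hK with rfl | hK
      · exact ⟨hf, hH⟩
      · exact h2 K hK
    · rw [hy.flat H hf, mul_zero]
      exact Submodule.zero_mem _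

lemma hsum_eq (y : Finset E → A) (G : Finset E) :
    hsum y G = y G + ∑ H with G ⊂ H, y H := by
  have : (Finset.univ.filter fun H : Finset E => G ⊆ H) =
      insert G (Finset.univ.filter fun H => G ⊂ H) := by
    ext H
    simp only [Finset.mem_filter, Finset.mem_univ, true_and, Finset.mem_insert]
    rw [Finset.ssubset_iff_subset_ne]
    constructor
    · intro h
      by_cases h' : H = G
      · exact Or.inl h'
      · exact Or.inr ⟨h, fun h => h' h.symm⟩
    · rintro (rfl | h)
      · exact subset_rfl
      · exact h.1
  rw [hsum, this, Finset.sum_insert (by simp)]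

lemma ChowData.mono_eq_zero (hy : ChowData M y) {s : Multiset (Finset E)} {G K : Finset E}
    (hG : G ∈ s) (hK : K ∈ s) (h1 : ¬G ⊆ K) (h2 : ¬K ⊆ G) : mono y s = 0 := by
  obtain ⟨t, rfl⟩ := Multiset.exists_cons_of_mem hG
  rcases Multiset.mem_cons.1 hK with rfl | hK
  · exact absurd subset_rfl h1
  obtain ⟨u, rfl⟩ := Multiset.exists_cons_of_mem hK
  rw [mono_cons, mono_cons, ← mul_assoc, hy.inc _ _ h1 h2, zero_mul]

/-- The weight of a multiset of flats. -/
noncomputable def wt (M : FinMatroid E) (s : Multiset (Finset E)) : ℕ := (s.map M.rank).sum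

lemma wt_le (s : Multiset (Finset E)) : wt M s ≤ s.card * M.rk := by
  have := Multiset.sum_le_card_nsmul (s.map M.rank) M.rk (by
    intro x hx
    obtain ⟨K, -, rfl⟩ := Multiset.mem_map.1 hx
    exact M.rank_le_rk K)
  simpa [wt] using this

lemma le_wt {n : ℕ} (s : Multiset (Finset E)) (h : ∀ K ∈ s, n ≤ M.rank K) :
    s.card * n ≤ wt M s := by
  have := Multiset.card_nsmul_le_sum (s := s.map M.rank) (a := n) (by
    intro x hx
    obtain ⟨K, hK, rfl⟩ := Multiset.mem_map.1 hx
    exact h K hK)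
  simpa [wt] using this

lemma exists_split (s : Multiset (Finset E)) (G : Finset E) :
    ∃ a s', s = Multiset.replicate a G + s' ∧ (G ∈ s → 1 ≤ a) ∧ ∀ K ∈ s', K ∈ s ∧ K ≠ G := by
  classical
  refine ⟨s.count G, s.filter (fun K => K ≠ G), ?_, fun h => Multiset.one_le_count_iff_mem.2 h, ?_⟩
  · rw [← Multiset.filter_eq']
    exact (Multiset.filter_add_not _ s).symm
  · intro K hK
    exact Multiset.mem_filter.1 hK

lemma ChowData.mem_basSpan_aux (hy : ChowData M y) (N : ℕ) :
    ∀ F : Finset E, M.IsFlat F → M.rk - M.rank F = N → ∀ (w : ℕ) (s : Multiset (Finset E)),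
      (∀ G ∈ s, M.IsFlat G ∧ F ⊂ G) → s.card * M.rk - wt M s = w →
      y F * mono y s ∈ basSpan M y F s.card := by
  induction N using Nat.strong_induction_on with
  | _ N ihN =>
  intro F hF hN w
  induction w using Nat.strong_induction_on with
  | _ w ihw =>
  intro s hs hw
  by_cases hs0 : s = 0
  · subst hs0
    exact Submodule.subset_span ⟨[], 0, by simp [Bas], by simp [ms], by simp [ms]⟩
  -- a minimal element
  obtain ⟨G, hGs, hGmin⟩ : ∃ G ∈ s, ∀ K ∈ s, K ⊆ G → K = G := by
    obtain ⟨K0, hK0⟩ := Multiset.exists_mem_of_ne_zero hs0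
    obtain ⟨G, hG, hmin⟩ := Finset.exists_min_image s.toFinset Finset.card
      ⟨K0, Multiset.mem_toFinset.2 hK0⟩
    refine ⟨G, Multiset.mem_toFinset.1 hG, fun K hK hKG => ?_⟩
    exact Finset.eq_of_subset_of_card_le hKG (hmin K (Multiset.mem_toFinset.2 hK))
  by_cases hinc : ∃ K ∈ s, ¬G ⊆ K
  · obtain ⟨K, hK, hGK⟩ := hinc
    rw [hy.mono_eq_zero hGs hK hGK (fun h => hGK (by rw [hGmin K hK h])), mul_zero]
    exact Submodule.zero_mem _
  push Not at hinc
  obtain ⟨hGf, hFG⟩ := hs G hGs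
  obtain ⟨a, s', hsplit, ha, hs'⟩ := exists_split s G
  replace ha := ha hGs
  have hs'' : ∀ K ∈ s', M.IsFlat K ∧ G ⊂ K := fun K hK =>
    ⟨(hs K (hs' K hK).1).1,
      Finset.ssubset_iff_subset_ne.2 ⟨hinc K (hs' K hK).1, fun h => (hs' K hK).2 h.symm⟩⟩
  have hrFG := M.rank_lt hF hFG
  have hmono : mono y s = y G ^ a * mono y s' := by rw [hsplit, mono_add, mono_replicate]
  have hcard : s.card = a + s'.card := by rw [hsplit]; simp
  obtain ⟨r, hr⟩ : ∃ r, M.rank G = M.rank F + r + 1 := ⟨M.rank G - M.rank F - 1, by omega⟩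
  have hrel := hy.mul_hsum_pow hF r G hGf hFG hr
  by_cases hGu : G = Finset.univ
  · have hs0' : s' = 0 := by
      refine Multiset.eq_zero_of_forall_notMem fun K hK => ?_
      have := (hs'' K hK).2
      rw [hGu] at this
      exact this.2 (Finset.subset_univ _)
    have hrk : M.rank G = M.rk := by rw [hGu]; rfl
    by_cases har : a ≤ M.rk - 1 - M.rank F
    · refine Submodule.subset_span ⟨[], a, har, ?_, ?_⟩
      · simp [ms, hcard, hs0']
      · rw [hmono, hs0', ms, mono_replicate, mono_zero, mul_one, hGu]
    · have hh : hsum y G = y G := by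
        rw [hsum_eq, hGu]
        rw [Finset.sum_eq_zero, add_zero]
        intro H hH
        exact absurd (Finset.subset_univ _) (Finset.mem_filter.1 hH).2.2
      rw [hh] at hrel
      obtain ⟨c, rfl⟩ : ∃ c, a = r + 1 + c := ⟨a - (r + 1), by omega⟩
      have : y F * mono y s = 0 := by
        rw [hmono, pow_add, ← mul_assoc, ← mul_assoc, hrel]; ring
      rw [this]
      exact Submodule.zero_mem _
  by_cases har : a + M.rank F < M.rank G
  · have h1 := ihN (M.rk - M.rank G) (by have := M.rank_le_rk G; omega) G hGf rfl _ s' hs'' rfl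
    obtain ⟨b, rfl⟩ : ∃ b, a = b + 1 := ⟨a - 1, by omega⟩
    have h2 : y F * mono y s = (y F * y G ^ b) * (y G * mono y s') := by
      rw [hmono]; ring
    rw [h2]
    refine mul_mem_of_span h1 ?_
    rintro t ⟨l, e, h3, h4, rfl⟩
    refine Submodule.subset_span ⟨(G, b + 1) :: l, e, ⟨hGf, hFG, hGu, ha, har, h3⟩, ?_, ?_⟩
    · simp only [ms, h4, hcard, Multiset.card_add, Multiset.card_replicate]
    · rw [ms, mono_add, mono_replicate]; ring
  · obtain ⟨c, rfl⟩ : ∃ c, a = r + 1 + c := ⟨a - (r + 1), by omega⟩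
    have h1 : y F * y G ^ (r + 1) = - ∑ j ∈ Finset.range (r + 1),
        y F * (y G ^ j * (∑ H with G ⊂ H, y H) ^ (r + 1 - j) * ((r + 1).choose j : A)) := by
      rw [hsum_eq, add_pow, Finset.sum_range_succ] at hrel
      rw [← Finset.mul_sum]
      simp only [Nat.sub_self, pow_zero, Nat.choose_self, Nat.cast_one, mul_one] at hrel
      linear_combination hrel
    have h2 : y F * mono y s = - ∑ j ∈ Finset.range (r + 1),
        ((r + 1).choose j : ℤ) • ((y F * y G ^ (c + j) * mono y s') *
          (∑ H with G ⊂ H, y H) ^ (r + 1 - j)) := by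
      have : y F * mono y s = (y F * y G ^ (r + 1)) * (y G ^ c * mono y s') := by
        rw [hmono]; ring
      rw [this, h1, neg_mul, Finset.sum_mul]
      congr 1
      refine Finset.sum_congr rfl fun j _ => ?_
      rw [zsmul_eq_mul, pow_add]
      push_cast
      ring
    rw [h2]
    refine Submodule.neg_mem _ (Submodule.sum_mem _ fun j hj => Submodule.smul_mem _ _ ?_)
    rw [Finset.mem_range] at hj
    refine mul_mem_of_span (hy.sum_pow_mem G _) ?_
    rintro t ⟨w', h3, h4, rfl⟩
    have h5 : y F * y G ^ (c + j) * mono y s' * mono y w' =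
        y F * mono y (Multiset.replicate (c + j) G + s' + w') := by
      rw [mono_add, mono_add, mono_replicate]; ring
    have h6 : s.card = (Multiset.replicate (c + j) G + s' + w').card := by
      simp only [Multiset.card_add, Multiset.card_replicate, h3, hcard]; omega
    rw [h5, h6]
    refine ihw _ ?_ _ ?_ rfl
    · have h7 := wt_le (M := M) (Multiset.replicate (c + j) G + s' + w')
      have h8 := le_wt (M := M) (n := M.rank G + 1) w' (fun K hK => M.rank_lt hGf (h4 K hK).2)
      rw [← h6] at h7 ⊢
      have h9 : wt M s < wt M (Multiset.replicate (c + j) G + s' + w') := by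
        rw [hsplit]
        rw [h3] at h8
        simp only [wt, Multiset.map_add, Multiset.sum_add, Multiset.map_replicate,
          Multiset.sum_replicate, smul_eq_mul] at h8 ⊢
        obtain ⟨q, hq⟩ : ∃ q, r + 1 = j + q + 1 := ⟨r - j, by omega⟩
        have : r + 1 - j = q + 1 := by omega
        rw [this] at h8
        rw [hq]
        nlinarith
      omega
    · intro K hK
      rw [Multiset.mem_add, Multiset.mem_add, Multiset.mem_replicate] at hK
      rcases hK with (hK | hK) | hK
      · rw [hK.2]; exact ⟨hGf, hFG⟩
      · exact ⟨(hs'' K hK).1, hFG.trans (hs'' K hK).2⟩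
      · exact ⟨(h4 K hK).1, hFG.trans (h4 K hK).2⟩

/-- Straightening: every monomial is a combination of basis monomials. -/
lemma ChowData.mem_basSpan (hy : ChowData M y) {F : Finset E} (hF : M.IsFlat F)
    {s : Multiset (Finset E)} (hs : ∀ G ∈ s, M.IsFlat G ∧ F ⊂ G) :
    y F * mono y s ∈ basSpan M y F s.card :=
  hy.mem_basSpan_aux _ F hF rfl _ s hs rfl

/-- Vanishing above the top degree. -/
lemma ChowData.vanish (hy : ChowData M y) {F : Finset E} (hF : M.IsFlat F)
    (hF' : F ≠ Finset.univ) {s : Multiset (Finset E)} (hs : ∀ G ∈ s, M.IsFlat G ∧ F ⊂ G)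
    (hc : M.rk ≤ M.rank F + s.card) : y F * mono y s = 0 := by
  have h := hy.mem_basSpan hF hs
  have h0 : {x | ∃ l e, Bas M F l e ∧ (ms l e).card = s.card ∧ x = y F * mono y (ms l e)} = ∅ := by
    ext x
    simp only [Set.mem_ofPred_eq, Set.mem_empty_iff_false, iff_false]
    rintro ⟨l, e, h1, h2, -⟩
    have := h1.card_lt hF hF'
    omega
  rw [basSpan, h0] at h
  simpa using h

end Straightening

end FinMatroid

namespace FinMatroid

section Pairing

variable {E : Type*} [Fintype E] [DecidableEq E]
variable {A : Type*} [CommRing A] {M : FinMatroid E} {y : Finset E → A}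

/-- The complementary list. -/
noncomputable def compL (M : FinMatroid E) :
    Finset E → List (Finset E × ℕ) → List (Finset E × ℕ)
  | _, [] => []
  | F, p :: l => (p.1, M.rank p.1 - M.rank F - p.2) :: compL M p.1 l

/-- The complementary exponent of the ground set. -/
noncomputable def compE (M : FinMatroid E) : Finset E → List (Finset E × ℕ) → ℕ → ℕ
  | F, [], e => M.rk - 1 - M.rank F - e
  | _, p :: l, e => compE M p.1 l e

lemma Bas.comp {l : List (Finset E × ℕ)} : ∀ {F : Finset E} {e : ℕ}, Bas M F l e →
    Bas M F (compL M F l) (compE M F l e) := by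
  induction l with
  | nil =>
    intro F e h
    simp only [Bas, compL, compE] at h ⊢
    omega
  | cons p l ih =>
    intro F e h
    obtain ⟨h1, h2, h3, h4, h5, h6⟩ := h
    refine ⟨h1, h2, h3, ?_, ?_, ih h6⟩ <;> simp only <;> omega

lemma Bas.compL_compL {l : List (Finset E × ℕ)} : ∀ {F : Finset E} {e : ℕ}, Bas M F l e →
    compL M F (compL M F l) = l := by
  induction l with
  | nil => intro F e h; rfl
  | cons p l ih =>
    intro F e h
    obtain ⟨h1, h2, h3, h4, h5, h6⟩ := h
    simp only [compL]
    rw [ih h6]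
    congr 1
    ext1
    · rfl
    · simp only; omega

lemma Bas.compE_compE {l : List (Finset E × ℕ)} : ∀ {F : Finset E} {e : ℕ}, Bas M F l e →
    compE M F (compL M F l) (compE M F l e) = e := by
  induction l with
  | nil =>
    intro F e h
    simp only [Bas, compL, compE] at h ⊢
    omega
  | cons p l ih =>
    intro F e h
    obtain ⟨h1, h2, h3, h4, h5, h6⟩ := h
    simp only [compL, compE]
    exact ih h6

lemma Bas.card_comp {l : List (Finset E × ℕ)} : ∀ {F : Finset E} {e : ℕ}, M.IsFlat F →
    F ≠ Finset.univ → Bas M F l e →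
    (ms l e).card + (ms (compL M F l) (compE M F l e)).card + M.rank F + 1 = M.rk := by
  induction l with
  | nil =>
    intro F e hF hF' h
    have := M.rank_lt_rk hF hF'
    simp only [Bas, compL, compE, ms, Multiset.card_replicate] at h ⊢
    omega
  | cons p l ih =>
    intro F e hF hF' h
    obtain ⟨h1, h2, h3, h4, h5, h6⟩ := h
    have := ih h1 h3 h6
    simp only [compL, compE, ms, Multiset.card_add, Multiset.card_replicate]
    omega

/-- One step towards a complete flag. -/
lemma ChowData.step (hy : ChowData M y) {F G : Finset E} {b : E} (hF : M.IsFlat F)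
    (hG : M.IsFlat G) (hFG : F ⊂ G) (hbG : b ∈ G) (hbF : b ∉ F)
    (hne : M.closure (insert b F) ≠ G) {m : Multiset (Finset E)} {n δ : ℕ}
    (hm : ∀ K ∈ m, M.IsFlat K ∧ G ⊂ K)
    (hδ : G = Finset.univ ∧ m = 0 ∧ δ = 0 ∨
      G ≠ Finset.univ ∧ M.rank G + m.card + 1 = M.rk ∧ δ = 1)
    (hn : n + 1 + M.rank F + 1 = M.rank G + δ) :
    y F * y G ^ (n + 1) * mono y m =
      -(y F * (y (M.closure (insert b F)) * y G ^ n * mono y m)) := by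
  set G1 := M.closure (insert b F) with hG1
  have hG1f : M.IsFlat G1 := M.isFlat_closure _
  have hG1G : G1 ⊆ G := M.closure_subset hG (Finset.insert_subset hbG hFG.1)
  have hr1 : M.rank G1 = M.rank F + 1 := by
    rw [hG1, M.rank_closure, M.rank_lt_of_notMem hF hbF]
  have hr2 := M.rank_lt hG1f (Finset.ssubset_iff_subset_ne.2 ⟨hG1G, hne⟩)
  have h0 : y F * hsum y G1 = 0 := hy.mul_hsum hG1.symm subset_rfl hbF
  have h1 : ∑ H with G1 ⊆ H, y F * (y H * (y G ^ n * mono y m)) = 0 := by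
    have : (y F * hsum y G1) * (y G ^ n * mono y m) = 0 := by rw [h0, zero_mul]
    rw [← this, hsum, Finset.mul_sum, Finset.sum_mul]
    exact Finset.sum_congr rfl fun H _ => by ring
  rw [Finset.sum_eq_add G1 G hne] at h1
  · linear_combination h1
  · intro H hH hHne
    simp only [Finset.mem_filter, Finset.mem_univ, true_and] at hH
    by_cases hHf : M.IsFlat H
    swap
    · rw [hy.flat H hHf]; ring
    have hr3 := M.rank_lt hG1f (Finset.ssubset_iff_subset_ne.2 ⟨hH, hHne.1.symm⟩)
    by_cases hHG : H ⊆ G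
    · have hHG' : H ⊂ G := Finset.ssubset_iff_subset_ne.2 ⟨hHG, hHne.2⟩
      have hHu : H ≠ Finset.univ := by
        rintro rfl
        exact hHG'.2 (Finset.subset_univ _)
      have hv := hy.vanish hHf hHu (s := Multiset.replicate n G + m) (by
        intro K hK
        rw [Multiset.mem_add, Multiset.mem_replicate] at hK
        rcases hK with hK | hK
        · rw [hK.2]; exact ⟨hG, hHG'⟩
        · exact ⟨(hm K hK).1, hHG'.trans (hm K hK).2⟩) (by
        simp only [Multiset.card_add, Multiset.card_replicate]
        rcases hδ with ⟨h, h', h''⟩ | ⟨h, h', h''⟩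
        · have : M.rank G = M.rk := by rw [h]; rfl
          omega
        · omega)
      rw [mono_add, mono_replicate] at hv
      rw [hv, mul_zero]
    · rcases hδ with ⟨h, h', h''⟩ | ⟨h, h', h''⟩
      · rw [h] at hHG
        exact absurd (Finset.subset_univ _) hHG
      · obtain ⟨q, rfl⟩ : ∃ q, n = q + 1 := ⟨n - 1, by omega⟩
        by_cases hGH : G ⊆ H
        · have hv := hy.vanish hG h (s := H ::ₘ m) (by
            intro K hK
            rcases Multiset.mem_cons.1 hK with rfl | hK
            · exact ⟨hHf, Finset.ssubset_iff_subset_ne.2 ⟨hGH, hHne.2.symm⟩⟩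
            · exact hm K hK) (by simp only [Multiset.card_cons]; omega)
          rw [mono_cons] at hv
          rw [pow_succ]
          linear_combination (y F * y G ^ q) * hv
        · have := hy.inc H G hHG hGH
          rw [pow_succ]
          linear_combination (y F * y G ^ q * mono y m) * this
  · intro h
    simp at h
  · intro h
    simp [hG1G] at h

/-- Strict chains of proper flats above `F`. -/
def Ch (M : FinMatroid E) : Finset E → List (Finset E) → Prop
  | _, [] => True
  | F, H :: l => M.IsFlat H ∧ F ⊂ H ∧ H ≠ Finset.univ ∧ Ch M H l

lemma ChowData.flag_aux (hy : ChowData M y) {G : Finset E} (hG : M.IsFlat G)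
    {m : Multiset (Finset E)} {δ : ℕ} (hm : ∀ K ∈ m, M.IsFlat K ∧ G ⊂ K)
    (hδ : G = Finset.univ ∧ m = 0 ∧ δ = 0 ∨
      G ≠ Finset.univ ∧ M.rank G + m.card + 1 = M.rk ∧ δ = 1) (n : ℕ) :
    ∀ F, M.IsFlat F → F ⊂ G → n + M.rank F + 1 = M.rank G + δ →
    ∃ (fl : List (Finset E)) (ε : ℤ), IsUnit ε ∧ fl.length + δ = n ∧
      (∀ tail, (∀ K, K ⊂ G → Ch M K tail) → Ch M F (fl ++ tail)) ∧
      y F * y G ^ n * mono y m = ε * (y F * (mono y (fl : Multiset (Finset E)) *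
        y G ^ δ * mono y m)) := by
  induction n with
  | zero =>
    intro F hF hFG hn
    have h1 := M.rank_lt hF hFG
    have h2 : δ = 0 := by omega
    subst h2
    exact ⟨[], 1, isUnit_one, rfl, fun tail h => h F hFG, by simp [mono]⟩
  | succ n ih =>
    intro F hF hFG hn
    obtain ⟨b, hbG, hbF⟩ := Finset.exists_of_ssubset hFG
    by_cases hne : M.closure (insert b F) = G
    · have hr : M.rank G = M.rank F + 1 := by
        rw [← hne, M.rank_closure, M.rank_lt_of_notMem hF hbF]
      have h3 : n + 1 = δ := by omega
      refine ⟨[], 1, isUnit_one, by simp [h3], fun tail h => h F hFG, ?_⟩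
      rw [h3]
      simp [mono]
      ring
    · have hr : M.rank (M.closure (insert b F)) = M.rank F + 1 := by
        rw [M.rank_closure, M.rank_lt_of_notMem hF hbF]
      have hsub : M.closure (insert b F) ⊂ G := Finset.ssubset_iff_subset_ne.2
        ⟨M.closure_subset hG (Finset.insert_subset hbG hFG.1), hne⟩
      have hsub2 : F ⊂ M.closure (insert b F) := by
        refine Finset.ssubset_iff_subset_ne.2
          ⟨(Finset.subset_insert _ _).trans (M.subset_closure _), fun h => ?_⟩
        rw [← h] at hr
        omega
      obtain ⟨fl, ε, h1, h2, h3, h4⟩ := ih _ (M.isFlat_closure _) hsub (by omega)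
      refine ⟨M.closure (insert b F) :: fl, -ε, h1.neg, by simp only [List.length_cons]; omega,
        ?_, ?_⟩
      · intro tail ht
        refine ⟨M.isFlat_closure _, hsub2, ?_, h3 tail ht⟩
        intro h
        rw [h] at hsub
        exact hsub.2 (Finset.subset_univ _)
      · rw [hy.step hF hG hFG hbG hbF hne hm hδ hn, h4, ← Multiset.cons_coe, mono_cons]
        push_cast
        ring

lemma Ch.mem {l : List (Finset E)} : ∀ {F : Finset E}, Ch M F l →
    ∀ K ∈ l, M.IsFlat K ∧ F ⊂ K := by
  induction l with
  | nil => intro F _ K hK; simp at hK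
  | cons H l ih =>
    intro F h K hK
    obtain ⟨h1, h2, h3, h4⟩ := h
    rcases List.mem_cons.1 hK with rfl | hK
    · exact ⟨h1, h2⟩
    · exact ⟨(ih h4 K hK).1, h2.trans (ih h4 K hK).2⟩

/-- The diagonal entries are monomials of complete flags up to sign. -/
lemma ChowData.diag (hy : ChowData M y) {l : List (Finset E × ℕ)} :
    ∀ {F : Finset E} {e : ℕ}, M.IsFlat F → F ≠ Finset.univ → Bas M F l e →
    ∃ (fl : List (Finset E)) (ε : ℤ), IsUnit ε ∧ Ch M F fl ∧ fl.length + M.rank F + 1 = M.rk ∧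
      y F * (mono y (ms l e) * mono y (ms (compL M F l) (compE M F l e))) =
        ε * (y F * mono y (fl : Multiset (Finset E))) := by
  induction l with
  | nil =>
    intro F e hF hF' h
    have hr := M.rank_lt_rk hF hF'
    have hru : M.rank Finset.univ = M.rk := rfl
    obtain ⟨fl, ε, h1, h2, h3, h4⟩ := hy.flag_aux M.isFlat_univ (m := 0) (δ := 0) (by simp)
      (Or.inl ⟨rfl, rfl, rfl⟩) (M.rk - 1 - M.rank F) F hF (Finset.ssubset_univ_iff.2 hF')
      (by omega)
    refine ⟨fl, ε, h1, ?_, by omega, ?_⟩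
    · simpa using h3 [] (fun _ _ => trivial)
    · simp only [Bas] at h
      rw [ms, compL, compE, ms, mono_replicate, mono_replicate, ← pow_add,
        show e + (M.rk - 1 - M.rank F - e) = M.rk - 1 - M.rank F by omega]
      simpa [mono_zero] using h4
  | cons p l ih =>
    intro F e hF hF' h
    obtain ⟨h1, h2, h3, h4, h5, h6⟩ := h
    obtain ⟨fl, ε, hε, hch, hlen, heq⟩ := ih h1 h3 h6
    obtain ⟨fl', ε', hε', hlen', hch', heq'⟩ := hy.flag_aux h1
      (m := (fl : Multiset (Finset E))) (δ := 1) (fun K hK => hch.mem K (by simpa using hK))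
      (Or.inr ⟨h3, by simp only [Multiset.coe_card]; omega, rfl⟩) (M.rank p.1 - M.rank F) F hF h2
      (by omega)
    refine ⟨fl' ++ p.1 :: fl, ε * ε', hε.mul hε', hch' _ ?_, ?_, ?_⟩
    · intro K hK
      exact ⟨h1, hK, h3, hch⟩
    · simp only [List.length_append, List.length_cons]; omega
    · obtain ⟨q, hq⟩ : ∃ q, M.rank p.1 - M.rank F = q + 1 :=
        ⟨M.rank p.1 - M.rank F - 1, by omega⟩
      have hpow : y p.1 ^ p.2 * y p.1 ^ (M.rank p.1 - M.rank F - p.2) = y p.1 ^ (q + 1) := by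
        rw [← pow_add]; congr 1; omega
      rw [← Multiset.coe_add, ← Multiset.cons_coe, mono_add, mono_cons]
      simp only [compL, compE, ms, mono_add, mono_replicate]
      rw [hq] at heq'
      push_cast
      linear_combination (y F * mono y (ms l e) * mono y (ms (compL M p.1 l) (compE M p.1 l e))) *
        hpow + (y F * y p.1 ^ q) * heq + (ε : A) * heq'

/-- A linearly ordered code for lists. -/
noncomputable def code (l : List (Finset E × ℕ)) : List (ℕ ×ₗ ℕ) :=
  l.map fun p => toLex ((Fintype.equivFin (Finset E) p.1 : ℕ), p.2)

lemma code_injective : Function.Injective (code (E := E)) := by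
  apply List.map_injective_iff.2
  rintro ⟨F, a⟩ ⟨G, b⟩ h
  have h' := toLex.injective h
  simp only [Prod.mk.injEq] at h'
  have := (Fintype.equivFin (Finset E)).injective (Fin.ext h'.1)
  rw [this, h'.2]

/-- Vanishing below the diagonal. -/
lemma ChowData.tri (hy : ChowData M y) {l : List (Finset E × ℕ)} :
    ∀ {F : Finset E} {e e' : ℕ} {l' : List (Finset E × ℕ)}, M.IsFlat F → F ≠ Finset.univ →
    Bas M F l e → Bas M F l' e' → (ms l e).card + (ms l' e').card + M.rank F + 1 = M.rk →
    y F * (mono y (ms l e) * mono y (ms l' e')) ≠ 0 →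
    compL M F l = l' ∨ code (compL M F l) < code l' := by
  induction l with
  | nil =>
    intro F e e' l' hF hF' h h' hc hne
    cases l' with
    | nil => exact Or.inl rfl
    | cons p l' =>
      exfalso
      apply hne
      obtain ⟨h1, h2, h3, h4, h5, h6⟩ := h'
      have hv := hy.vanish h1 h3 (s := ms [] e + ms l' e') (by
        intro K hK
        rcases Multiset.mem_add.1 hK with hK | hK
        · rw [ms, Multiset.mem_replicate] at hK
          rw [hK.2]
          exact ⟨M.isFlat_univ, Finset.ssubset_univ_iff.2 h3⟩
        · exact h6.mem_ms h3 K hK) (by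
        simp only [ms, Multiset.card_add, Multiset.card_replicate] at hc ⊢
        omega)
      obtain ⟨q, hq⟩ : ∃ q, p.2 = q + 1 := ⟨p.2 - 1, by omega⟩
      rw [mono_add] at hv
      rw [ms.eq_2 _ p, mono_add, mono_replicate, hq]
      linear_combination (y F * y p.1 ^ q) * hv
  | cons p l ih =>
    intro F e e' l' hF hF' h h' hc hne
    have hh := h
    obtain ⟨h1, h2, h3, h4, h5, h6⟩ := h
    obtain ⟨q, hq⟩ : ∃ q, p.2 = q + 1 := ⟨p.2 - 1, by omega⟩
    cases l' with
    | nil =>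
      exfalso
      apply hne
      have hv := hy.vanish h1 h3 (s := ms l e + ms [] e') (by
        intro K hK
        rcases Multiset.mem_add.1 hK with hK | hK
        · exact h6.mem_ms h3 K hK
        · rw [ms, Multiset.mem_replicate] at hK
          rw [hK.2]
          exact ⟨M.isFlat_univ, Finset.ssubset_univ_iff.2 h3⟩) (by
        simp only [ms, Multiset.card_add, Multiset.card_replicate] at hc ⊢
        omega)
      rw [mono_add] at hv
      rw [ms.eq_2 _ p, mono_add, mono_replicate, hq]
      linear_combination (y F * y p.1 ^ q) * hv
    | cons p' l' =>
      have hh' := h'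
      obtain ⟨h1', h2', h3', h4', h5', h6'⟩ := h'
      obtain ⟨q', hq'⟩ : ∃ q, p'.2 = q + 1 := ⟨p'.2 - 1, by omega⟩
      have hc' := hc
      simp only [ms, Multiset.card_add, Multiset.card_replicate] at hc'
      by_cases heq : p.1 = p'.1
      · obtain ⟨G, a⟩ := p
        obtain ⟨G', a'⟩ := p'
        simp only at heq
        subst heq
        simp only at *
        rcases lt_trichotomy (a + a' + M.rank F) (M.rank G) with hlt | heq | hgt
        · exfalso
          apply hne
          have hv := hy.vanish h1 h3 (s := ms l e + ms l' e') (by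
            intro K hK
            rcases Multiset.mem_add.1 hK with hK | hK
            · exact h6.mem_ms h3 K hK
            · exact h6'.mem_ms h3 K hK) (by simp only [Multiset.card_add]; omega)
          rw [mono_add] at hv
          rw [ms, ms, mono_add, mono_replicate, mono_add, mono_replicate, hq]
          linear_combination (y F * y G ^ q * y G ^ a') * hv
        · have := ih h1 h3 h6 h6' (by omega) (by
            intro h0
            apply hne
            rw [ms, ms, mono_add, mono_replicate, mono_add, mono_replicate, hq]
            linear_combination (y F * y G ^ q * y G ^ a') * h0)
          have hsub : M.rank G - M.rank F - a = a' := by omega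
          simp only [compL, hsub]
          rcases this with h | h
          · exact Or.inl (by rw [h])
          · right
            simp only [code, List.map_cons] at h ⊢
            exact List.cons_lt_cons_iff.2 (Or.inr ⟨rfl, h⟩)
        · right
          simp only [compL, code, List.map_cons]
          refine List.cons_lt_cons_iff.2 (Or.inl ?_)
          rw [Prod.Lex.toLex_lt_toLex]
          exact Or.inr ⟨rfl, by simp only; omega⟩
      · exfalso
        apply hne
        by_cases hs : p.1 ⊆ p'.1
        · have hss : p.1 ⊂ p'.1 := Finset.ssubset_iff_subset_ne.2 ⟨hs, heq⟩
          have hv := hy.vanish h1 h3 (s := ms l e + ms (p' :: l') e') (by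
            intro K hK
            rcases Multiset.mem_add.1 hK with hK | hK
            · exact h6.mem_ms h3 K hK
            · rw [ms, Multiset.mem_add, Multiset.mem_replicate] at hK
              rcases hK with hK | hK
              · rw [hK.2]; exact ⟨h1', hss⟩
              · exact ⟨(h6'.mem_ms h3' K hK).1, hss.trans (h6'.mem_ms h3' K hK).2⟩) (by
            simp only [ms, Multiset.card_add, Multiset.card_replicate]; omega)
          rw [mono_add] at hv
          rw [ms.eq_2 _ p, mono_add, mono_replicate, hq]
          linear_combination (y F * y p.1 ^ q) * hv
        by_cases hs' : p'.1 ⊆ p.1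
        · have hss : p'.1 ⊂ p.1 := Finset.ssubset_iff_subset_ne.2 ⟨hs', fun h => heq h.symm⟩
          have hv := hy.vanish h1' h3' (s := ms (p :: l) e + ms l' e') (by
            intro K hK
            rcases Multiset.mem_add.1 hK with hK | hK
            · rw [ms, Multiset.mem_add, Multiset.mem_replicate] at hK
              rcases hK with hK | hK
              · rw [hK.2]; exact ⟨h1, hss⟩
              · exact ⟨(h6.mem_ms h3 K hK).1, hss.trans (h6.mem_ms h3 K hK).2⟩
            · exact h6'.mem_ms h3' K hK) (by
            simp only [ms, Multiset.card_add, Multiset.card_replicate]; omega)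
          rw [mono_add] at hv
          rw [ms.eq_2 _ p', mono_add, mono_replicate, hq']
          linear_combination (y F * y p'.1 ^ q') * hv
        · have := hy.inc _ _ hs hs'
          rw [ms, ms, mono_add, mono_replicate, mono_add, mono_replicate, hq, hq']
          linear_combination (y F * y p.1 ^ q * y p'.1 ^ q' * mono y (ms l e) *
            mono y (ms l' e')) * this

lemma finite_bas (N : ℕ) : ∀ F : Finset E, M.rk - M.rank F = N →
    {p : List (Finset E × ℕ) × ℕ | Bas M F p.1 p.2}.Finite := by
  induction N using Nat.strong_induction_on with
  | _ N ih =>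
  intro F hN
  have key : {p : List (Finset E × ℕ) × ℕ | Bas M F p.1 p.2} ⊆
      ((fun e => ([], e)) '' Set.Iic (M.rk - 1 - M.rank F)) ∪
      ⋃ G ∈ {G : Finset E | M.rank F < M.rank G}, ⋃ a ∈ Set.Iic (M.rank G),
        (fun p : List (Finset E × ℕ) × ℕ => ((G, a) :: p.1, p.2)) ''
          {p : List (Finset E × ℕ) × ℕ | Bas M G p.1 p.2} := by
    rintro ⟨l, e⟩ h
    cases l with
    | nil => exact Or.inl ⟨e, h, rfl⟩
    | cons p l =>
      obtain ⟨h1, h2, h3, h4, h5, h6⟩ := h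
      right
      simp only [Set.mem_iUnion]
      exact ⟨p.1, show M.rank F < M.rank p.1 by omega, p.2,
        show p.2 ≤ M.rank p.1 by omega, (l, e), h6, rfl⟩
  refine Set.Finite.subset ?_ key
  refine Set.Finite.union ((Set.finite_Iic _).image _) ?_
  refine Set.Finite.biUnion (Set.toFinite _) fun G hG => ?_
  refine Set.Finite.biUnion (Set.finite_Iic _) fun a _ => Set.Finite.image _ ?_
  have hG' : M.rank F < M.rank G := hG
  have := M.rank_le_rk G
  exact ih (M.rk - M.rank G) (by omega) G rfl

end Pairing

/-- Linear algebra: a triangular integer matrix with unit diagonal entries is invertible. -/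
lemma triangular_invertible {I α : Type*} [Fintype I] [LinearOrder α] (c : I → α)
    (hc : Function.Injective c) (P : I → I → ℤ) (hd : ∀ i, IsUnit (P i i))
    (ht : ∀ i j, P i j ≠ 0 → i = j ∨ c i < c j) :
    (∀ x : I → ℤ, (∀ j, ∑ i, x i * P i j = 0) → x = 0) ∧
      ∀ φ : I → ℤ, ∃ x : I → ℤ, ∀ j, ∑ i, x i * P i j = φ j := by
  classical
  let _ : LinearOrder I := LinearOrder.lift' c hc
  have hdet : IsUnit (Matrix.of P).det := by
    rw [Matrix.det_of_isUpperTriangular]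
    · rw [IsUnit.prod_univ_iff]
      exact hd
    · intro i j hij
      by_contra h
      rcases ht i j h with rfl | h
      · exact lt_irrefl _ hij
      · exact lt_asymm h hij
  constructor
  · intro x hx
    have h0 : Matrix.vecMul x (Matrix.of P) = 0 := funext hx
    have h1 : Matrix.vecMul (Matrix.vecMul x (Matrix.of P)) (Matrix.of P)⁻¹ = x := by
      rw [Matrix.vecMul_vecMul, Matrix.mul_nonsing_inv _ hdet, Matrix.vecMul_one]
    rw [← h1, h0, Matrix.zero_vecMul]
  · intro φ
    refine ⟨Matrix.vecMul φ (Matrix.of P)⁻¹, fun j => ?_⟩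
    have h1 : Matrix.vecMul (Matrix.vecMul φ (Matrix.of P)⁻¹) (Matrix.of P) = φ := by
      rw [Matrix.vecMul_vecMul, Matrix.nonsing_inv_mul _ hdet, Matrix.vecMul_one]
    exact congrFun h1 j

end FinMatroid

namespace FinMatroid

section Final

variable {E : Type*} [Fintype E] [DecidableEq E]

open Classical in
/-- The variables of the Chow ring, with value `1` at the empty set and the extra variable
for the ground set. -/
noncomputable def yv (M : FinMatroid E) (a0 : E) (F : Finset E) : ChowRing ℤ M :=
  if h : M.IsFlat F ∧ F ≠ ∅ ∧ F ≠ Finset.univ then chowMk ℤ M (MvPolynomial.X ⟨F, h⟩)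
  else if F = ∅ then 1
  else if F = Finset.univ then
    chowMk ℤ M (-∑ G : ProperFlat M, if a0 ∈ G.1 then MvPolynomial.X G else 0)
  else 0

variable {M : FinMatroid E} {a0 : E}

lemma yv_proper (G : ProperFlat M) : yv M a0 G.1 = chowMk ℤ M (MvPolynomial.X G) := by
  rw [yv, dif_pos G.2]
  rfl

lemma yv_empty : yv M a0 ∅ = 1 := by
  rw [yv, dif_neg (by simp), if_pos rfl]

lemma yv_univ : yv M a0 Finset.univ =
    chowMk ℤ M (-∑ G : ProperFlat M, if a0 ∈ G.1 then MvPolynomial.X G else 0) := by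
  have : (Finset.univ : Finset E) ≠ ∅ := Finset.ne_empty_of_mem (Finset.mem_univ a0)
  rw [yv, dif_neg (by simp), if_neg this, if_pos rfl]

/-- The underlying set of a proper flat, as an embedding. -/
def pv (M : FinMatroid E) : ProperFlat M ↪ Finset E :=
  ⟨fun G => G.1, fun _ _ h => Subtype.ext h⟩

lemma yv_chowData (hM : M.Loopless) : ChowData M (yv M a0) where
  lin a := by
    classical
    rw [Finset.sum_filter]
    have hu : (Finset.univ : Finset E) ∈ (Finset.univ : Finset (Finset E)) := Finset.mem_univ _
    rw [← Finset.add_sum_erase _ _ hu, if_pos (Finset.mem_univ a), yv_univ]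
    have h1 : ∑ H ∈ Finset.univ.erase (Finset.univ : Finset E),
        (if a ∈ H then yv M a0 H else 0) =
        chowMk ℤ M (∑ G : ProperFlat M, if a ∈ G.1 then MvPolynomial.X G else 0) := by
      have h2 : ∑ G : ProperFlat M, (if a ∈ G.1 then yv M a0 G.1 else 0) =
          chowMk ℤ M (∑ G : ProperFlat M, if a ∈ G.1 then MvPolynomial.X G else 0) := by
        rw [map_sum]
        refine Finset.sum_congr rfl fun G _ => ?_
        split_ifs
        · exact yv_proper G
        · rw [map_zero]
      rw [← h2]
      symm
      refine (Finset.sum_map Finset.univ (pv M)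
        (fun H => if a ∈ H then yv M a0 H else 0)).symm.trans ?_
      refine Finset.sum_subset ?_ ?_
      · intro H hH
        rw [Finset.mem_map] at hH
        obtain ⟨G, -, rfl⟩ := hH
        exact Finset.mem_erase.2 ⟨G.2.2.2, Finset.mem_univ _⟩
      · intro H hH hH'
        split_ifs with haH
        · have hH1 := (Finset.mem_erase.1 hH).1
          rw [yv, dif_neg, if_neg (Finset.ne_empty_of_mem haH), if_neg hH1]
          intro h
          exact hH' (Finset.mem_map.2 ⟨⟨H, h⟩, Finset.mem_univ _, rfl⟩)
        · rfl
    rw [h1, ← map_add, neg_add_eq_sub]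
    refine Ideal.Quotient.eq_zero_iff_mem.2 (Ideal.subset_span (Or.inl ⟨(a, a0), rfl⟩))
  inc F G h1 h2 := by
    have hF1 : F ≠ ∅ := by rintro rfl; exact h1 (Finset.empty_subset _)
    have hF2 : F ≠ Finset.univ := by rintro rfl; exact h2 (Finset.subset_univ _)
    have hG1 : G ≠ ∅ := by rintro rfl; exact h2 (Finset.empty_subset _)
    have hG2 : G ≠ Finset.univ := by rintro rfl; exact h1 (Finset.subset_univ _)
    by_cases hF : M.IsFlat F
    swap
    · rw [yv, dif_neg (fun h => hF h.1), if_neg hF1, if_neg hF2, zero_mul]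
    by_cases hG : M.IsFlat G
    swap
    · rw [yv.eq_1 M a0 G, dif_neg (fun h => hG h.1), if_neg hG1, if_neg hG2, mul_zero]
    rw [yv, yv, dif_pos ⟨hF, hF1, hF2⟩, dif_pos ⟨hG, hG1, hG2⟩, ← map_mul]
    exact Ideal.Quotient.eq_zero_iff_mem.2 (Ideal.subset_span (Or.inr ⟨_, _, h1, h2, rfl⟩))
  flat F hF := by
    have hF1 : F ≠ ∅ := by rintro rfl; exact hF hM
    have hF2 : F ≠ Finset.univ := by rintro rfl; exact hF M.isFlat_univ
    rw [yv, dif_neg (fun h => hF h.1), if_neg hF1, if_neg hF2]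

lemma yv_mem_piece {G : Finset E} (hG : G ≠ ∅) : yv M a0 G ∈ piece ℤ M 1 := by
  rw [yv]
  split_ifs with h1
  · exact mk_mem_piece ℤ (MvPolynomial.isHomogeneous_X _ _)
  · refine mk_mem_piece ℤ (MvPolynomial.IsHomogeneous.neg ?_)
    have := isHomogeneous_comb ℤ M (fun G => a0 ∈ G.1) (fun _ => 1)
    simpa using this
  · exact Submodule.zero_mem _

lemma mono_mem_piece (s : Multiset (Finset E)) :
    (∀ G ∈ s, G ≠ ∅) → mono (yv M a0) s ∈ piece ℤ M s.card := by
  induction s using Multiset.induction_on with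
  | empty =>
    intro _
    rw [mono_zero]
    have := mk_mem_piece ℤ (M := M) (MvPolynomial.isHomogeneous_one (ProperFlat M) ℤ)
    simpa using this
  | cons G s ih =>
    intro h
    rw [mono_cons, Multiset.card_cons, add_comm]
    exact mul_mem_piece ℤ (yv_mem_piece (h G (Multiset.mem_cons_self _ _)))
      (ih fun K hK => h K (Multiset.mem_cons_of_mem hK))

lemma piece_le_basSpan (hM : M.Loopless) (k : ℕ) :
    piece ℤ M k ≤ basSpan M (yv M a0) ∅ k := by
  rintro _ ⟨p, hp, rfl⟩
  have hp' : p.IsHomogeneous k := (MvPolynomial.mem_homogeneousSubmodule _ _).1 hp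
  rw [← MvPolynomial.support_sum_monomial_coeff p, map_sum]
  refine Submodule.sum_mem _ fun m hm => ?_
  have hdeg : m.degree = k := by
    have := hp' (MvPolynomial.mem_support_iff.1 hm)
    rwa [Finsupp.degree_eq_weight_one]
  have hmon : (chowMk ℤ M).toLinearMap (MvPolynomial.monomial m (p.coeff m)) =
      p.coeff m • (yv M a0 ∅ * mono (yv M a0) (m.toMultiset.map (fun G : ProperFlat M => G.1))) := by
    rw [yv_empty, one_mul, mono, Multiset.map_map]
    have h1 : ((m.toMultiset).map (yv M a0 ∘ (fun G : ProperFlat M => G.1))).prod =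
        chowMk ℤ M ((m.toMultiset.map MvPolynomial.X).prod) := by
      rw [map_multiset_prod, Multiset.map_map]
      congr 1
      refine Multiset.map_congr rfl fun G _ => ?_
      exact yv_proper G
    have h2 : (m.toMultiset.map MvPolynomial.X).prod =
        (MvPolynomial.monomial m 1 : MvPolynomial (ProperFlat M) ℤ) := by
      rw [MvPolynomial.monomial_eq, Finsupp.toMultiset_map, Finsupp.prod_toMultiset]
      rw [map_one, one_mul, Finsupp.prod_mapDomain_index]
      · simp
      · simp [pow_add]
    rw [h1, h2, AlgHom.toLinearMap_apply, ← map_smul, MvPolynomial.smul_monomial, smul_eq_mul,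
      mul_one]
  rw [hmon]
  refine Submodule.smul_mem _ _ ?_
  have hcard : (m.toMultiset.map (fun G : ProperFlat M => G.1)).card = k := by
    rw [Multiset.card_map, Finsupp.card_toMultiset, ← hdeg]
    rfl
  rw [← hcard]
  refine (yv_chowData hM).mem_basSpan hM ?_
  intro G hG
  obtain ⟨H, -, rfl⟩ := Multiset.mem_map.1 hG
  exact ⟨H.2.1, Finset.empty_ssubset.2 (Finset.nonempty_iff_ne_empty.2 H.2.2.1)⟩

lemma Ch.exists_flag {fl : List (Finset E)} : ∀ {F : Finset E}, F ≠ ∅ ∨ F = ∅ → Ch M F fl →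
    (fl.Pairwise (· ⊂ ·)) ∧ ∀ H ∈ fl, M.IsFlat H ∧ H ≠ ∅ ∧ H ≠ Finset.univ := by
  induction fl with
  | nil => intro F _ _; simp
  | cons H l ih =>
    intro F _ h
    obtain ⟨h1, h2, h3, h4⟩ := h
    obtain ⟨h5, h6⟩ := ih (em' _) h4
    refine ⟨List.pairwise_cons.2 ⟨fun K hK => (h4.mem K hK).2, h5⟩, ?_⟩
    intro K hK
    rcases List.mem_cons.1 hK with rfl | hK
    · refine ⟨h1, ?_, h3⟩
      rintro rfl
      exact h2.2 (Finset.empty_subset _)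
    · exact h6 K hK

/-- The index type of basis monomials of degree `k`. -/
def Idx (M : FinMatroid E) (k : ℕ) : Type _ :=
  {p : List (Finset E × ℕ) × ℕ // Bas M ∅ p.1 p.2 ∧ (ms p.1 p.2).card = k}

instance (M : FinMatroid E) (k : ℕ) : Finite (Idx M k) :=
  ((finite_bas (M := M) _ ∅ rfl).subset (fun _ h => h.1)).to_subtype

lemma ms_card_succ (l : List (Finset E × ℕ)) (e : ℕ) :
    (ms l e).card = (l.map Prod.snd).sum + e := by
  induction l with
  | nil => simp [ms]
  | cons p l ih => simp [ms, ih, add_assoc]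

end Final

end FinMatroid

set_option synthInstance.maxHeartbeats 1000000 in
set_option maxHeartbeats 1000000 in
open FinMatroid in
/-- **Adiprasito–Huh–Katz, Poincaré duality.** Let `M` be a loopless matroid of rank `d+1`
and let `deg : A^d(M) ≅ ℤ` be the degree isomorphism (characterized by sending each monomial
attached to a complete flag of nonempty proper flats to `1`). For `0 ≤ k ≤ d`, the map
`A^k(M) → Hom_ℤ(A^{d-k}(M), ℤ)` induced by multiplication followed by `deg` is an
isomorphism of abelian groups. -/
theorem chow_poincare_duality {E : Type*} [Fintype E] [DecidableEq E]
    (M : FinMatroid E) (hM : M.Loopless) (d : ℕ) (hrk : M.rk = d + 1)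
    (deg : (piece ℤ M d) →+ ℤ) (hdeg_bij : Function.Bijective deg)
    (hdeg : ∀ flag : Fin d → ProperFlat M, (∀ i j : Fin d, i < j → (flag i).1 ⊂ (flag j).1) →
      deg ⟨chowMk ℤ M (∏ i, MvPolynomial.X (flag i)), flagMonomial_mem ℤ M d flag⟩ = 1)
    (k : ℕ) (hk : k ≤ d) :
    ∃ Φ : (piece ℤ M k) →+ ((piece ℤ M (d - k)) →+ ℤ),
      (∀ (a : piece ℤ M k) (b : piece ℤ M (d - k)),
        Φ a b = deg ⟨(a : ChowRing ℤ M) * (b : ChowRing ℤ M), by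
          have h := mul_mem_piece ℤ a.2 b.2
          rwa [Nat.add_sub_cancel' hk] at h⟩) ∧
      Function.Bijective Φ := by
  classical
  have hmul : ∀ (a : piece ℤ M k) (b : piece ℤ M (d - k)),
      (a : ChowRing ℤ M) * (b : ChowRing ℤ M) ∈ piece ℤ M d := by
    intro a b
    have h := mul_mem_piece ℤ a.2 b.2
    rwa [Nat.add_sub_cancel' hk] at h
  let Φ : (piece ℤ M k) →+ ((piece ℤ M (d - k)) →+ ℤ) :=
    AddMonoidHom.mk' (fun a => AddMonoidHom.mk' (fun b => deg ⟨_, hmul a b⟩) (by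
      intro b b'
      rw [← map_add]
      congr 1
      exact Subtype.ext (mul_add _ _ _))) (by
      intro a a'
      ext b
      change deg _ = deg _ + deg _
      rw [← map_add]
      congr 1
      exact Subtype.ext (add_mul _ _ _))
  have hΦ : ∀ a b, Φ a b = deg ⟨_, hmul a b⟩ := fun _ _ => rfl
  refine ⟨Φ, hΦ, ?_⟩
  -- a ground set element
  obtain ⟨a0⟩ : Nonempty E := by
    by_contra hE
    rw [not_nonempty_iff] at hE
    have h1 : (Finset.univ : Finset E) = ∅ := Finset.univ_eq_empty
    have h2 : M.rk = M.rank Finset.univ := rfl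
    rw [h1, M.rank_empty] at h2
    omega
  have hy : ChowData M (yv M a0) := yv_chowData hM
  have hE : (∅ : Finset E) ≠ Finset.univ := (Finset.ne_empty_of_mem (Finset.mem_univ a0)).symm
  have hr0 := M.rank_empty
  let _ : Fintype (Idx M k) := Fintype.ofFinite _
  have hne : ∀ {l : List (Finset E × ℕ)} {e : ℕ}, Bas M ∅ l e → ∀ G ∈ ms l e, G ≠ ∅ := by
    intro l e h G hG
    have := (h.mem_ms hE G hG).2
    exact (Finset.nonempty_iff_ne_empty.1 (Finset.empty_ssubset.1 this))
  let u : Idx M k → piece ℤ M k := fun i => ⟨mono (yv M a0) (ms i.1.1 i.1.2), by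
    have := mono_mem_piece (M := M) (a0 := a0) _ (hne i.2.1)
    rwa [i.2.2] at this⟩
  have hcardc : ∀ i : Idx M k,
      (ms (compL M ∅ i.1.1) (compE M ∅ i.1.1 i.1.2)).card = d - k := by
    intro i
    have h1 := i.2.1.card_comp hM hE
    have h2 := i.2.2
    omega
  let v : Idx M k → piece ℤ M (d - k) := fun i =>
    ⟨mono (yv M a0) (ms (compL M ∅ i.1.1) (compE M ∅ i.1.1 i.1.2)), by
      have := mono_mem_piece (M := M) (a0 := a0) _ (hne i.2.1.comp)
      rwa [hcardc i] at this⟩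
  -- spanning
  have hu : ∀ a : piece ℤ M k, ∃ x : Idx M k → ℤ, a = ∑ i, x i • u i := by
    intro a
    have ha : (a : ChowRing ℤ M) ∈ Submodule.span ℤ (Set.range fun i => (u i : ChowRing ℤ M)) := by
      have h1 := piece_le_basSpan (a0 := a0) hM k a.2
      refine Submodule.span_mono ?_ h1
      rintro _ ⟨l, e, h2, h3, rfl⟩
      exact ⟨⟨(l, e), h2, h3⟩, by rw [yv_empty, one_mul]⟩
    obtain ⟨x, hx⟩ := (Submodule.mem_span_range_iff_exists_fun ℤ).1 ha
    refine ⟨x, Subtype.ext ?_⟩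
    rw [← hx]
    simp
  have hv : ∀ (f g : piece ℤ M (d - k) →+ ℤ), (∀ i, f (v i) = g (v i)) → f = g := by
    intro f g hfg
    ext b
    have hb : (b : ChowRing ℤ M) ∈ Submodule.span ℤ (Set.range fun i => (v i : ChowRing ℤ M)) := by
      have h1 := piece_le_basSpan (a0 := a0) hM (d - k) b.2
      refine Submodule.span_mono ?_ h1
      rintro _ ⟨l, e, h2, h3, rfl⟩
      have h4 := h2.card_comp hM hE
      refine ⟨⟨(compL M ∅ l, compE M ∅ l e), h2.comp, by simp only; omega⟩, ?_⟩
      rw [yv_empty, one_mul]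
      simp only [v]
      rw [h2.compL_compL, h2.compE_compE]
    obtain ⟨x, hx⟩ := (Submodule.mem_span_range_iff_exists_fun ℤ).1 hb
    have hb' : b = ∑ i, x i • v i := by
      refine Subtype.ext ?_
      rw [← hx]
      simp
    rw [hb', map_sum, map_sum]
    refine Finset.sum_congr rfl fun i _ => ?_
    rw [map_zsmul, map_zsmul, hfg]
  -- the matrix
  let P : Idx M k → Idx M k → ℤ := fun i j => Φ (u i) (v j)
  have hdiag : ∀ i, IsUnit (P i i) := by
    intro i
    obtain ⟨fl, ε, hε, hch, hlen, heq⟩ := hy.diag hM hE i.2.1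
    rw [yv_empty, one_mul, one_mul] at heq
    obtain ⟨hpw, hfl⟩ := hch.exists_flag (em' _)
    have hlen' : fl.length = d := by omega
    subst hlen'
    have h1 := hdeg (fun i => ⟨fl.get i, hfl _ (List.get_mem _ _)⟩)
      (fun i j hij => List.pairwise_iff_get.1 hpw i j hij)
    have h2 : chowMk ℤ M (∏ i : Fin fl.length,
        MvPolynomial.X (⟨fl.get i, hfl _ (List.get_mem _ _)⟩ : ProperFlat M)) =
        mono (yv M a0) (fl : Multiset (Finset E)) := by
      rw [map_prod, mono, Multiset.map_coe, Multiset.prod_coe]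
      have h3 : ∀ i : Fin fl.length, chowMk ℤ M
          (MvPolynomial.X (⟨fl.get i, hfl _ (List.get_mem _ _)⟩ : ProperFlat M)) =
          yv M a0 (fl.get i) := fun i => (yv_proper (a0 := a0) (M := M) ⟨fl.get i, _⟩).symm
      rw [Finset.prod_congr rfl fun i _ => h3 i]
      rw [← List.prod_ofFn]
      congr 1
      exact List.ext_getElem (by simp) (by simp)
    have h4 : P i i = ε := by
      have h5 : (⟨_, hmul (u i) (v i)⟩ : piece ℤ M fl.length) = ε • ⟨_, flagMonomial_mem ℤ M _
          (fun i => ⟨fl.get i, hfl _ (List.get_mem _ _)⟩)⟩ := by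
        refine Subtype.ext ?_
        rw [Submodule.coe_smul, zsmul_eq_mul]
        simp only
        rw [h2]
        exact heq
      change deg _ = _
      rw [h5, map_zsmul, h1]
      simp
    rw [h4]
    exact hε
  let c : Idx M k → List (ℕ ×ₗ ℕ) := fun i => code (compL M ∅ i.1.1)
  have hcinj : ∀ i j : Idx M k, compL M ∅ i.1.1 = compL M ∅ j.1.1 → i = j := by
    intro i j h
    have h1 : i.1.1 = j.1.1 := by
      rw [← i.2.1.compL_compL, h, j.2.1.compL_compL]
    have h2 := i.2.2
    have h3 := j.2.2
    rw [ms_card_succ] at h2 h3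
    rw [h1] at h2
    exact Subtype.ext (Prod.ext h1 (by omega))
  have htri : ∀ i j, P i j ≠ 0 → i = j ∨ c i < c j := by
    intro i j h
    have h1 := hcardc j
    have h2 := i.2.2
    rcases hy.tri hM hE i.2.1 j.2.1.comp (by omega) (by
      intro h0
      apply h
      rw [yv_empty, one_mul] at h0
      have h5 : (⟨_, hmul (u i) (v j)⟩ : piece ℤ M d) = 0 := Subtype.ext h0
      change deg _ = _
      rw [h5, map_zero]) with h | h
    · exact Or.inl (hcinj i j h)
    · exact Or.inr h
  obtain ⟨hinj, hsurj⟩ := triangular_invertible c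
    (fun i j h => hcinj i j (code_injective h)) P hdiag htri
  have hsum : ∀ (x : Idx M k → ℤ) j, Φ (∑ i, x i • u i) (v j) = ∑ i, x i * P i j := by
    intro x j
    rw [map_sum, AddMonoidHom.finsetSum_apply]
    refine Finset.sum_congr rfl fun i _ => ?_
    rw [map_zsmul]
    simp [P]
  constructor
  · rw [injective_iff_map_eq_zero]
    intro a ha
    obtain ⟨x, rfl⟩ := hu a
    have : x = 0 := hinj x fun j => by
      rw [← hsum, ha]
      rfl
    simp [this]
  · intro f
    obtain ⟨x, hx⟩ := hsurj fun j => f (v j)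
    refine ⟨∑ i, x i • u i, hv _ _ fun j => ?_⟩
    rw [hsum, hx]
end

section
/- (Mason–Welsh conjecture, proved by Adiprasito–Huh–Katz) Let M be a matroid of rank r on a finite ground set E, and for 0 ≤ k ≤ r let f_k(M) be the number of independent subsets of E of cardinality k. Then the sequence f_0(M), f_1(M), …, f_r(M) is log-concave, and hence unimodal. -/
namespace FinMatroid

variable {E : Type*} [Fintype E] [DecidableEq E]

/-- A basis is a maximal independent set. -/
def IsBase (M : FinMatroid E) (B : Finset E) : Prop :=
  M.Indep B ∧ ∀ ⦃J⦄, M.Indep J → B ⊆ J → J = B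

open Classical in
/-- The finset of all flats of `M`. -/
noncomputable def flats (M : FinMatroid E) : Finset (Finset E) :=
  Finset.univ.filter fun F => M.IsFlat F

open Classical in
/-- `mu` is the Möbius function of the lattice of flats of `M`: it satisfies `mu F F = 1`,
`mu F F' = 0` when `¬ F ⊆ F'`, and for `F ⊂ F'` the sum of `mu F G` over the flats
`F ⊆ G ⊆ F'` vanishes. These properties determine `mu` uniquely on pairs of flats. -/
def IsMobius (M : FinMatroid E) (mu : Finset E → Finset E → ℤ) : Prop :=
  (∀ F ∈ M.flats, mu F F = 1) ∧
  (∀ F ∈ M.flats, ∀ F' ∈ M.flats, ¬F ⊆ F' → mu F F' = 0) ∧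
  (∀ F ∈ M.flats, ∀ F' ∈ M.flats, F ⊂ F' →
    ∑ G ∈ M.flats.filter (fun G => F ⊆ G ∧ G ⊆ F'), mu F G = 0)

open Classical in
/-- The characteristic polynomial of a matroid `M` (relative to the Möbius function `mu` of
its lattice of flats): `χ_M(t) = Σ_{F ∈ L(M)} μ(∅,F) t^{r(E) - r(F)}` if `M` is loopless,
and `0` if `M` has a loop. -/
noncomputable def charPoly (M : FinMatroid E) (mu : Finset E → Finset E → ℤ) : Polynomial ℤ :=
  if M.Loopless then
    ∑ F ∈ M.flats, Polynomial.C (mu ∅ F) * Polynomial.X ^ (M.rk - M.rank F)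
  else 0

end FinMatroid

open Classical in
/-- The number of independent subsets of the ground set of cardinality `k`. -/
noncomputable def FinMatroid.numIndep {E : Type*} [Fintype E] [DecidableEq E]
    (M : FinMatroid E) (k : ℕ) : ℕ :=
  ((Finset.univ : Finset (Finset E)).filter fun I => M.Indep I ∧ I.card = k).card

theorem mw_LA {V : Type*} [Fintype V] [DecidableEq V] (H : V → V → ℝ)
    (hs : ∀ e f, H e f = H f e) (hn : ∀ e f, 0 ≤ H e f)
    (hq : ∀ x : V → ℝ, ∑ e, ∑ f, x e * H e f * x f ≤
      ∑ e, (∑ f, H e f * x f) ^ 2 / (∑ f, H e f))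
    (hc : ∀ u : V → ℝ, (∀ e f, 0 < H e f → u e = u f) →
      ∀ e f, 0 < ∑ g, H e g → 0 < ∑ g, H f g → u e = u f)
    (z : V → ℝ) (hz : ∑ e, z e * ∑ f, H e f = 0) :
    ∑ e, ∑ f, z e * H e f * z f ≤ 0 := by
  set r : V → ℝ := fun e => ∑ f, H e f with hr
  have hr0 : ∀ e, 0 ≤ r e := fun e => Finset.sum_nonneg fun f _ => hn e f
  have hrH : ∀ e f, r e = 0 → H e f = 0 := by
    intro e f h
    exact (Finset.sum_eq_zero_iff_of_nonneg (fun f _ => hn e f)).1 h f (Finset.mem_univ _)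
  set s : V → ℝ := fun e => √(r e) with hsd
  have hss : ∀ e, s e * s e = r e := fun e => Real.mul_self_sqrt (hr0 e)
  have hs0 : ∀ e, s e = 0 → r e = 0 := by
    intro e h; rw [← hss, h]; simp
  let S : Matrix V V ℝ := Matrix.of fun e f => H e f / (s e * s f)
  have hSe : ∀ e f, S e f = H e f / (s e * s f) := fun e f => rfl
  have hS : S.IsHermitian := by
    ext e f
    simp only [Matrix.conjTranspose_apply, hSe, star_trivial]
    rw [hs, mul_comm]
  have hHS : ∀ e f, H e f = s e * S e f * s f := by
    intro e f
    rw [hSe]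
    by_cases h1 : s e = 0
    · rw [hrH e f (hs0 e h1), h1]; simp
    by_cases h2 : s f = 0
    · rw [hs, hrH f e (hs0 f h2), h2]; simp
    field_simp
  -- eigenvectors
  have key : ∀ (v : V → ℝ) (μ : ℝ), 0 < μ → (∀ e, ∑ f, S e f * v f = μ * v e) →
      ∑ e, v e * (s e * z e) = 0 := by
    intro v μ hμ hv
    have hv0 : ∀ e, s e = 0 → v e = 0 := by
      intro e he
      have := hv e
      rw [Finset.sum_eq_zero (fun f _ => by rw [hSe, he]; simp)] at this
      rcases mul_eq_zero.1 this.symm with h | h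
      · exact absurd h hμ.ne'
      · exact h
    set x : V → ℝ := fun e => v e / s e with hx
    have hsx : ∀ e, s e * x e = v e := by
      intro e
      by_cases h : s e = 0
      · rw [hv0 e h, h]; simp
      · simp only [hx]; field_simp
    have hHx : ∀ e, ∑ f, H e f * x f = μ * (r e * x e) := by
      intro e
      calc ∑ f, H e f * x f = ∑ f, s e * (S e f * v f) := by
            refine Finset.sum_congr rfl fun f _ => ?_
            rw [hHS, ← hsx f]; ring
        _ = s e * (μ * v e) := by rw [← Finset.mul_sum, hv]
        _ = _ := by rw [← hsx e, ← hss]; ring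
    have hxHx : ∑ e, ∑ f, x e * H e f * x f = μ * ∑ e, r e * x e ^ 2 := by
      rw [Finset.mul_sum]
      refine Finset.sum_congr rfl fun e _ => ?_
      calc ∑ f, x e * H e f * x f = x e * ∑ f, H e f * x f := by
            rw [Finset.mul_sum]; exact Finset.sum_congr rfl fun f _ => by ring
        _ = _ := by rw [hHx]; ring
    set T := ∑ e, r e * x e ^ 2 with hT
    have hT0 : 0 ≤ T := Finset.sum_nonneg fun e _ => mul_nonneg (hr0 e) (sq_nonneg _)
    have h1 : μ * T ≤ μ ^ 2 * T := by
      have := hq x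
      rw [hxHx] at this
      refine this.trans (le_of_eq ?_)
      rw [hT, Finset.mul_sum]
      refine Finset.sum_congr rfl fun e _ => ?_
      change (∑ f, H e f * x f) ^ 2 / r e = _
      rw [hHx]
      by_cases h : r e = 0
      · rw [h]; simp
      · field_simp
    have h2 : μ * T ≥ T := by
      by_contra hlt
      push Not at hlt
      nlinarith
    have h3 : ∑ e, ∑ f, H e f * (x e - x f) ^ 2 = 2 * T - 2 * (μ * T) := by
      have a1 : ∑ e, ∑ f, H e f * x e ^ 2 = T := by
        rw [hT]; exact Finset.sum_congr rfl fun e _ => by rw [← Finset.sum_mul]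
      have a2 : ∑ e, ∑ f, H e f * x f ^ 2 = T := by
        rw [Finset.sum_comm, ← a1]
        exact Finset.sum_congr rfl fun e _ => Finset.sum_congr rfl fun f _ => by rw [hs]
      rw [← hxHx]
      have : ∑ e, ∑ f, H e f * (x e - x f) ^ 2 = ∑ e, ∑ f, H e f * x e ^ 2 +
          ∑ e, ∑ f, H e f * x f ^ 2 - 2 * ∑ e, ∑ f, x e * H e f * x f := by
        simp only [Finset.mul_sum, ← Finset.sum_add_distrib, ← Finset.sum_sub_distrib]
        exact Finset.sum_congr rfl fun e _ => Finset.sum_congr rfl fun f _ => by ring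
      rw [this, a1, a2]; ring
    have hnn : ∀ e f, 0 ≤ H e f * (x e - x f) ^ 2 := fun e f => mul_nonneg (hn e f) (sq_nonneg _)
    have h4 : ∑ e, ∑ f, H e f * (x e - x f) ^ 2 = 0 :=
      le_antisymm (by linarith) (Finset.sum_nonneg fun e _ => Finset.sum_nonneg fun f _ => hnn e f)
    have h5 : ∀ e f, 0 < H e f → x e = x f := by
      intro e f hef
      have := (Finset.sum_eq_zero_iff_of_nonneg
        (fun e _ => Finset.sum_nonneg fun f _ => hnn e f)).1 h4 e (Finset.mem_univ _)
      have := (Finset.sum_eq_zero_iff_of_nonneg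
        (fun f _ => hnn e f)).1 this f (Finset.mem_univ _)
      rcases mul_eq_zero.1 this with h | h
      · exact absurd h hef.ne'
      · have := pow_eq_zero_iff (two_ne_zero) |>.1 h
        linarith
    have h6 := hc x h5
    have h7 : ∑ e, v e * (s e * z e) = ∑ e, x e * (z e * r e) :=
      Finset.sum_congr rfl fun e _ => by rw [← hsx, ← hss]; ring
    rw [h7]
    by_cases hne : ∃ e0, 0 < r e0
    · obtain ⟨e0, he0⟩ := hne
      calc ∑ e, x e * (z e * r e) = ∑ e, x e0 * (z e * r e) := by
            refine Finset.sum_congr rfl fun e _ => ?_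
            rcases (hr0 e).eq_or_lt with h | h
            · rw [← h]; simp
            · rw [h6 e e0 h he0]
        _ = 0 := by rw [← Finset.mul_sum, hz, mul_zero]
    · push Not at hne
      refine Finset.sum_eq_zero fun e _ => ?_
      rw [le_antisymm (hne e) (hr0 e)]; simp
  -- spectral decomposition
  set b := hS.eigenvectorBasis with hb
  have hbv : ∀ i e, ∑ f, S e f * b i f = hS.eigenvalues i * b i e := by
    intro i e
    have := congrFun (hS.mulVec_eigenvectorBasis i) e
    simpa [Matrix.mulVec, dotProduct] using this
  let y : EuclideanSpace ℝ V := WithLp.toLp 2 fun e => s e * z e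
  let Sy : EuclideanSpace ℝ V := WithLp.toLp 2 fun e => ∑ f, S e f * (s f * z f)
  have e1 : ∑ e, ∑ f, z e * H e f * z f = inner ℝ y Sy := by
    simp only [PiLp.inner_apply, y, Sy]
    refine Finset.sum_congr rfl fun e _ => ?_
    simp only [RCLike.inner_apply, conj_trivial, Finset.sum_mul]
    refine Finset.sum_congr rfl fun f _ => ?_
    rw [hHS]; ring
  have e2 : ∀ i, inner ℝ (b i) Sy = hS.eigenvalues i * inner ℝ (b i) y := by
    intro i
    simp only [PiLp.inner_apply, y, Sy, RCLike.inner_apply, conj_trivial, Finset.sum_mul,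
      Finset.mul_sum]
    rw [Finset.sum_comm]
    refine Finset.sum_congr rfl fun f _ => ?_
    have := hbv i f
    calc ∑ e, S e f * (s f * z f) * b i e = (∑ e, S f e * b i e) * (s f * z f) := by
          rw [Finset.sum_mul]
          refine Finset.sum_congr rfl fun e _ => ?_
          have : S e f = S f e := by rw [hSe, hSe, hs, mul_comm]
          rw [this]; ring
      _ = _ := by rw [this]; ring
  rw [e1, ← b.sum_inner_mul_inner y Sy]
  refine Finset.sum_nonpos fun i _ => ?_
  rw [e2, real_inner_comm]
  by_cases hμ : 0 < hS.eigenvalues i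
  · have := key (fun e => b i e) _ hμ (hbv i)
    have h0 : inner ℝ (b i) y = 0 := by
      simp only [PiLp.inner_apply, y, RCLike.inner_apply, conj_trivial]
      rw [← this]; exact Finset.sum_congr rfl fun e _ => by ring
    rw [h0]; simp
  · push Not at hμ
    nlinarith [sq_nonneg (inner ℝ (b i) y)]

section MWaux

variable {V : Type*} [Fintype V] [DecidableEq V]

open Classical in
/-- weighted sum over the independent sets of size `d` containing `K` -/
noncomputable def mwF (M : FinMatroid V) (d : ℕ) (w : V → ℝ) (K : Finset V) : ℝ :=
  ∑ B : Finset V, if M.Indep B ∧ B.card = d ∧ K ⊆ B then ∏ e ∈ B, w e else 0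

noncomputable def mwG (M : FinMatroid V) (d : ℕ) (w : V → ℝ) (K : Finset V) (e : V) : ℝ :=
  if e ∈ K then 0 else mwF M d w (insert e K)

noncomputable def mwH (M : FinMatroid V) (d : ℕ) (w : V → ℝ) (J : Finset V) (e f : V) : ℝ :=
  if e ∈ J then 0 else mwG M d w (insert e J) f

variable (M : FinMatroid V) (d : ℕ) (w : V → ℝ)

theorem mwF_nonneg (hw : ∀ e, 0 < w e) (K : Finset V) : 0 ≤ mwF M d w K := by
  classical
  unfold mwF
  refine Finset.sum_nonneg fun B _ => ?_
  split_ifs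
  · exact Finset.prod_nonneg fun e _ => (hw e).le
  · exact le_rfl

theorem mwG_nonneg (hw : ∀ e, 0 < w e) (K : Finset V) (e : V) : 0 ≤ mwG M d w K e := by
  unfold mwG
  split_ifs
  · exact le_rfl
  · exact mwF_nonneg M d w hw _

theorem mwH_nonneg (hw : ∀ e, 0 < w e) (K : Finset V) (e f : V) : 0 ≤ mwH M d w K e f := by
  unfold mwH
  split_ifs
  · exact le_rfl
  · exact mwG_nonneg M d w hw _ _

theorem mwH_symm (J : Finset V) (e f : V) : mwH M d w J e f = mwH M d w J f e := by
  unfold mwH mwG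
  by_cases h1 : e ∈ J <;> by_cases h2 : f ∈ J <;> by_cases h3 : e = f <;>
    simp [h1, h2, h3, Finset.insert_comm, eq_comm]

theorem mwG_sum (K : Finset V) : ∑ e, mwG M d w K e = ((d : ℝ) - K.card) * mwF M d w K := by
  classical
  unfold mwG mwF
  have : ∀ e, (if e ∈ K then (0:ℝ) else ∑ B : Finset V,
      if M.Indep B ∧ B.card = d ∧ insert e K ⊆ B then ∏ e ∈ B, w e else 0) =
      ∑ B : Finset V, if M.Indep B ∧ B.card = d ∧ K ⊆ B then
        (if e ∈ B \ K then ∏ e ∈ B, w e else 0) else 0 := by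
    intro e
    by_cases he : e ∈ K
    · simp [he]
    · rw [if_neg he]
      refine Finset.sum_congr rfl fun B _ => ?_
      by_cases h1 : M.Indep B <;> by_cases h2 : B.card = d <;> by_cases h3 : K ⊆ B <;>
        by_cases h4 : e ∈ B <;> simp [h1, h2, h3, h4, he, Finset.insert_subset_iff]
  simp only [this]
  rw [Finset.sum_comm, Finset.mul_sum]
  refine Finset.sum_congr rfl fun B _ => ?_
  split_ifs with h
  · rw [← Finset.sum_filter, Finset.sum_const, nsmul_eq_mul]
    congr 1
    have : (Finset.univ.filter fun x => x ∈ B \ K) = B \ K := by ext; simp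
    rw [this, Finset.card_sdiff_of_subset h.2.2, Nat.cast_sub (Finset.card_le_card h.2.2), h.2.1]
  · simp

theorem mwH_row (J : Finset V) (e : V) :
    ∑ f, mwH M d w J e f = ((d : ℝ) - J.card - 1) * mwG M d w J e := by
  unfold mwH
  by_cases h : e ∈ J
  · simp [h, mwG]
  · simp only [h, if_false]
    rw [mwG_sum, Finset.card_insert_of_notMem h]
    simp only [mwG, h, if_false]
    push_cast; ring

theorem mwH_sum (J : Finset V) (f g : V) :
    ∑ e, (if e ∈ J then 0 else mwH M d w (insert e J) f g) =
      ((d : ℝ) - J.card - 2) * mwH M d w J f g := by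
  by_cases hf : f ∈ J
  · simp [mwH, hf]
  by_cases hg : g ∈ insert f J
  · simp only [mwH, mwG, hf, hg, if_true, if_false, mul_zero]
    refine Finset.sum_eq_zero fun e _ => ?_
    have : g ∈ insert f (insert e J) := by
      simp only [Finset.mem_insert] at hg ⊢; tauto
    simp [this]
  · have h1 : mwH M d w J f g = mwF M d w (insert g (insert f J)) := by
      simp [mwH, mwG, hf, hg]
    have h2 := mwG_sum M d w (insert g (insert f J))
    rw [Finset.card_insert_of_notMem hg, Finset.card_insert_of_notMem hf] at h2
    rw [h1]
    push_cast at h2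
    rw [show (d : ℝ) - J.card - 2 = d - (J.card + 1 + 1) by ring, ← h2]
    refine Finset.sum_congr rfl fun e _ => ?_
    simp only [mwH, mwG]
    simp only [Finset.mem_insert, not_or] at hg ⊢
    have hperm : insert g (insert f (insert e J)) = insert e (insert g (insert f J)) := by
      ext; simp only [Finset.mem_insert]; tauto
    rw [hperm]
    by_cases h3 : e ∈ J
    · simp [h3]
    by_cases h4 : e = f
    · simp [h4]
    by_cases h5 : e = g
    · simp [h5]
    have h4' : f ≠ e := fun h => h4 h.symm
    have h5' : g ≠ e := fun h => h5 h.symm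
    simp [h3, h4, h5, hf, hg.1, hg.2, h4', h5']

theorem mwF_pos_iff (hw : ∀ e, 0 < w e) (K : Finset V) :
    0 < mwF M d w K ↔ ∃ B, M.Indep B ∧ B.card = d ∧ K ⊆ B := by
  classical
  have hnn : ∀ B ∈ (Finset.univ : Finset (Finset V)),
      0 ≤ if M.Indep B ∧ B.card = d ∧ K ⊆ B then ∏ e ∈ B, w e else 0 := by
    intro B _
    split_ifs
    · exact Finset.prod_nonneg fun e _ => (hw e).le
    · exact le_rfl
  constructor
  · intro h
    by_contra hne
    push Not at hne
    refine h.ne' ?_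
    unfold mwF
    refine Finset.sum_eq_zero fun B _ => ?_
    rw [if_neg]
    rintro ⟨a, b, c⟩
    exact hne B a b c
  · rintro ⟨B, hB⟩
    unfold mwF
    refine Finset.sum_pos' hnn ⟨B, Finset.mem_univ _, ?_⟩
    rw [if_pos hB]
    exact Finset.prod_pos fun e _ => hw e

theorem mw_extend {d : ℕ} {B : Finset V} (hB : M.Indep B) (hBd : B.card = d) :
    ∀ (n : ℕ) (K : Finset V), M.Indep K → K.card + n = d →
      ∃ B', M.Indep B' ∧ B'.card = d ∧ K ⊆ B' := by
  intro n
  induction n with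
  | zero => intro K hK h; exact ⟨K, hK, by simpa using h, le_rfl⟩
  | succ n ih =>
    intro K hK h
    obtain ⟨e, _, heK, hi⟩ := M.indep_exchange hK hB (by omega)
    obtain ⟨B', h1, h2, h3⟩ := ih (insert e K) hi (by rw [Finset.card_insert_of_notMem heK]; omega)
    exact ⟨B', h1, h2, (Finset.subset_insert _ _).trans h3⟩

theorem mw_par {J : Finset V} {e f g : V} (hf : f ∉ J) (hfi : M.Indep (insert f J))
    (he : e ∉ J) (hg : g ∉ insert e J) (hi : M.Indep (insert g (insert e J))) :
    (g ∉ insert f J ∧ M.Indep (insert g (insert f J))) ∨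
    (e ∉ insert f J ∧ M.Indep (insert e (insert f J))) := by
  obtain ⟨x, hx, hxn, hxi⟩ := M.indep_exchange hfi hi (by
    rw [Finset.card_insert_of_notMem hg, Finset.card_insert_of_notMem hf,
      Finset.card_insert_of_notMem he]; omega)
  simp only [Finset.mem_insert] at hx
  rcases hx with rfl | rfl | hx
  · exact Or.inl ⟨hxn, hxi⟩
  · exact Or.inr ⟨hxn, hxi⟩
  · exact absurd (Finset.mem_insert_of_mem hx) hxn

theorem mw_shift {U : Type*} [Fintype U] (H : U → U → ℝ) (hs : ∀ e f, H e f = H f e) (z : U → ℝ) (c : ℝ) :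
    ∑ e, ∑ f, (z e - c) * H e f * (z f - c) =
    ∑ e, ∑ f, z e * H e f * z f - 2 * c * ∑ e, z e * ∑ f, H e f + c ^ 2 * ∑ e, ∑ f, H e f := by
  have h1 : ∑ e, z e * ∑ f, H e f = ∑ e, ∑ f, z e * H e f := by simp only [Finset.mul_sum]
  have h2 : ∑ e, z e * ∑ f, H e f = ∑ e, ∑ f, H e f * z f := by
    rw [h1, Finset.sum_comm]
    exact Finset.sum_congr rfl fun e _ => Finset.sum_congr rfl fun f _ => by rw [hs]; ring
  have h3 : 2 * c * ∑ e, z e * ∑ f, H e f = c * ∑ e, ∑ f, z e * H e f + c * ∑ e, ∑ f, H e f * z f := by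
    rw [← h1, ← h2]; ring
  rw [h3]
  simp only [Finset.mul_sum, ← Finset.sum_add_distrib, ← Finset.sum_sub_distrib]
  exact Finset.sum_congr rfl fun e _ => Finset.sum_congr rfl fun f _ => by ring

theorem mwH_conn (hw : ∀ e, 0 < w e) (J : Finset V) (hJ : J.card + 2 ≤ d) (u : V → ℝ)
    (hu : ∀ e f, 0 < mwH M d w J e f → u e = u f) (e f : V)
    (he : 0 < mwG M d w J e) (hf : 0 < mwG M d w J f) : u e = u f := by
  have hG : ∀ e, 0 < mwG M d w J e → e ∉ J ∧ ∃ B, M.Indep B ∧ B.card = d ∧ insert e J ⊆ B := by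
    intro e he
    unfold mwG at he
    split_ifs at he with h
    · exact absurd he (lt_irrefl _)
    · exact ⟨h, (mwF_pos_iff M d w hw _).1 he⟩
  obtain ⟨heJ, B, hB, hBd, heB⟩ := hG e he
  obtain ⟨hfJ, B', hB', -, hfB⟩ := hG f hf
  have hfi := M.indep_subset hB' hfB
  have hei := M.indep_subset hB heB
  have hH : ∀ a b, a ∉ J → b ∉ insert a J → M.Indep (insert b (insert a J)) → u a = u b := by
    intro a b ha hb hi
    apply hu
    simp only [mwH, mwG, ha, hb, if_false]
    rw [mwF_pos_iff M d w hw]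
    refine mw_extend M hB hBd (d - (J.card + 2)) _ hi ?_
    rw [Finset.card_insert_of_notMem hb, Finset.card_insert_of_notMem ha]; omega
  obtain ⟨g, -, hg, hgi⟩ := M.indep_exchange hei hB (by
    rw [Finset.card_insert_of_notMem heJ]; omega)
  rcases mw_par M hfJ hfi heJ hg hgi with ⟨h1, h2⟩ | ⟨h1, h2⟩
  · rw [hH e g heJ hg hgi, hH f g hfJ h1 h2]
  · exact (hH f e hfJ h1 h2).symm

theorem mwF_top (K : Finset V) (hK : K.card = d) [Decidable (M.Indep K)] :
    mwF M d w K = if M.Indep K then ∏ e ∈ K, w e else 0 := by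
  classical
  unfold mwF
  rw [Finset.sum_eq_single K]
  · simp [hK]
  · intro B _ hB
    rw [if_neg]
    rintro ⟨_, h1, h2⟩
    exact hB (Finset.eq_of_subset_of_card_le h2 (by omega)).symm
  · simp

theorem mw_base (hw : ∀ e, 0 < w e) (J : Finset V) (hJ : J.card + 2 = d) (z : V → ℝ)
    (hz : ∑ e, z e * mwG M d w J e = 0) :
    ∑ e, ∑ f, z e * mwH M d w J e f * z f ≤ 0 := by
  classical
  let L : V → Prop := fun e => e ∉ J ∧ M.Indep (insert e J)
  let adj : V → V → Prop := fun e f => f ∉ insert e J ∧ M.Indep (insert f (insert e J))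
  let a : V → ℝ := fun e => if L e then w e else 0
  let W : ℝ := ∏ e ∈ J, w e
  have hW : 0 < W := Finset.prod_pos fun e _ => hw e
  have adj_symm : ∀ e f, L e → L f → adj e f → adj f e := by
    rintro e f he hf ⟨h1, h2⟩
    refine ⟨?_, by rwa [Finset.insert_comm]⟩
    simp only [Finset.mem_insert, not_or] at h1 ⊢
    exact ⟨fun h => h1.1 h.symm, he.1⟩
  let cls : V → Finset V := fun e => Finset.univ.filter fun f => L f ∧ ¬ adj e f
  have hcls : ∀ e f, L e → L f → (adj e f ↔ cls e ≠ cls f) := by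
    intro e f he hf
    constructor
    · intro h heq
      have : f ∈ cls f := by
        simp only [cls, Finset.mem_filter, Finset.mem_univ, true_and]
        exact ⟨hf, fun h => h.1 (Finset.mem_insert_self _ _)⟩
      rw [← heq] at this
      simp only [cls, Finset.mem_filter, Finset.mem_univ, true_and] at this
      exact this.2 h
    · intro hne
      by_contra hna
      apply hne
      ext g
      simp only [cls, Finset.mem_filter, Finset.mem_univ, true_and]
      refine and_congr_right fun hg => not_congr ?_
      constructor
      · rintro ⟨h1, h2⟩
        rcases mw_par M hf.1 hf.2 he.1 h1 h2 with h | h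
        · exact h
        · exact absurd (adj_symm f e hf he h) hna
      · rintro ⟨h1, h2⟩
        rcases mw_par M he.1 he.2 hf.1 h1 h2 with h | h
        · exact h
        · exact absurd h hna
  have hH : ∀ e f, mwH M d w J e f = W * (a e * a f * (if cls e = cls f then 0 else 1)) := by
    intro e f
    have h0 : ¬ (L e ∧ L f) → mwH M d w J e f = 0 := by
      intro h
      unfold mwH mwG
      split_ifs with h1 h2
      · rfl
      · rfl
      · rw [mwF_top M d w _ (by
          rw [Finset.card_insert_of_notMem h2, Finset.card_insert_of_notMem h1]; omega), if_neg]
        intro hi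
        apply h
        refine ⟨⟨h1, M.indep_subset hi (Finset.subset_insert _ _)⟩, ?_, M.indep_subset hi ?_⟩
        · exact fun h => h2 (Finset.mem_insert_of_mem h)
        · exact Finset.insert_subset_insert _ (Finset.subset_insert _ _)
    by_cases he : L e
    swap
    · rw [h0 (fun h => he h.1)]; simp [a, he]
    by_cases hf : L f
    swap
    · rw [h0 (fun h => hf h.2)]; simp [a, hf]
    simp only [a, he, hf, if_true]
    have he1 := he.1
    by_cases hadj : adj e f
    · rw [if_neg ((hcls e f he hf).1 hadj)]
      obtain ⟨h1, h2⟩ := hadj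
      simp only [mwH, mwG, he1, h1, if_false]
      rw [mwF_top M d w _ (by
          rw [Finset.card_insert_of_notMem h1, Finset.card_insert_of_notMem he1]; omega),
          if_pos h2, Finset.prod_insert h1, Finset.prod_insert he1]
      ring
    · have : cls e = cls f := by
        by_contra h
        exact hadj ((hcls e f he hf).2 h)
      rw [if_pos this]
      unfold mwH mwG
      split_ifs with h2
      · simp
      · rw [mwF_top M d w _ (by
          rw [Finset.card_insert_of_notMem h2, Finset.card_insert_of_notMem he1]; omega), if_neg]
        · simp
        · exact fun hi => hadj ⟨h2, hi⟩
  have hyp : ∀ x : V → ℝ, ∑ e, a e * x e = 0 → ∑ e, ∑ f, x e * mwH M d w J e f * x f ≤ 0 := by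
    intro x hx
    have e1 : ∑ e, ∑ f, x e * mwH M d w J e f * x f =
        W * ((∑ e, a e * x e) ^ 2 - ∑ C : Finset V, (∑ e, if cls e = C then a e * x e else 0) ^ 2) := by
      have e2 : ∑ C : Finset V, (∑ e, if cls e = C then a e * x e else 0) ^ 2 =
          ∑ e, ∑ f, if cls e = cls f then (a e * x e) * (a f * x f) else 0 := by
        simp only [sq, Finset.sum_mul_sum]
        rw [Finset.sum_comm]
        refine Finset.sum_congr rfl fun e _ => ?_
        rw [Finset.sum_comm]
        refine Finset.sum_congr rfl fun f _ => ?_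
        rw [Finset.sum_eq_single (cls e)]
        · by_cases h : cls e = cls f
          · simp [h]
          · simp [h, Ne.symm h]
        · intro C _ hC
          simp [Ne.symm hC]
        · simp
      rw [e2, sq, Finset.sum_mul_sum, ← Finset.sum_sub_distrib, Finset.mul_sum]
      refine Finset.sum_congr rfl fun e _ => ?_
      rw [← Finset.sum_sub_distrib, Finset.mul_sum]
      refine Finset.sum_congr rfl fun f _ => ?_
      rw [hH]
      split_ifs <;> ring
    rw [e1, hx]
    have : 0 ≤ ∑ C : Finset V, (∑ e, if cls e = C then a e * x e else 0) ^ 2 :=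
      Finset.sum_nonneg fun _ _ => sq_nonneg _
    nlinarith
  have ha : ∀ e, 0 ≤ a e := by
    intro e
    simp only [a]
    split_ifs
    · exact (hw e).le
    · exact le_rfl
  by_cases hA : ∑ e, a e = 0
  · have : ∀ e, a e = 0 := fun e =>
      (Finset.sum_eq_zero_iff_of_nonneg (fun e _ => ha e)).1 hA e (Finset.mem_univ _)
    simp [hH, this]
  · set c := (∑ e, a e * z e) / ∑ e, a e with hc
    have h1 := hyp (fun e => z e - c) (by
      simp only [mul_sub, Finset.sum_sub_distrib, ← Finset.sum_mul]
      rw [hc]; field_simp; ring)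
    rw [mw_shift _ (mwH_symm M d w J)] at h1
    have h2 : ∑ e, z e * ∑ f, mwH M d w J e f = 0 := by
      simp only [mwH_row]
      rw [show (d : ℝ) - J.card - 1 = 1 by rw [← hJ]; push_cast; ring]
      simpa using hz
    have h3 : 0 ≤ ∑ e, ∑ f, mwH M d w J e f :=
      Finset.sum_nonneg fun e _ => Finset.sum_nonneg fun f _ => mwH_nonneg M d w hw J e f
    rw [h2] at h1
    nlinarith [mul_nonneg (sq_nonneg c) h3]

theorem mw_main (hw : ∀ e, 0 < w e) : ∀ (n : ℕ) (J : Finset V), J.card + 2 + n = d →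
    ∀ z : V → ℝ, ∑ e, z e * mwG M d w J e = 0 →
    ∑ e, ∑ f, z e * mwH M d w J e f * z f ≤ 0 := by
  intro n
  induction n with
  | zero => intro J hJ z hz; exact mw_base M d w hw J hJ z hz
  | succ n ih =>
    intro J hJ z hz
    have ht : (d : ℝ) - J.card = n + 3 := by rw [← hJ]; push_cast; ring
    have hrow : ∀ e, ∑ f, mwH M d w J e f = (n + 2) * mwG M d w J e := by
      intro e; rw [mwH_row, ht]; ring
    have hn : (0:ℝ) ≤ n := Nat.cast_nonneg n
    refine mw_LA (mwH M d w J) (mwH_symm M d w J) (mwH_nonneg M d w hw J) ?_ ?_ z ?_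
    · intro x
      have hE : ∀ e, e ∉ J → ∑ f, ∑ g, x f * mwH M d w (insert e J) f g * x g ≤
          (n + 1) * ((∑ f, mwH M d w J e f * x f) ^ 2 / (∑ f, mwH M d w J e f)) := by
        intro e he
        have hcard : (insert e J).card = J.card + 1 := Finset.card_insert_of_notMem he
        have hGH : ∀ f, mwG M d w (insert e J) f = mwH M d w J e f := by
          intro f; simp [mwH, he]
        have IH := ih (insert e J) (by rw [hcard]; omega)
        simp only [hGH] at IH
        have hrow' : ∀ f, ∑ g, mwH M d w (insert e J) f g = (n + 1) * mwH M d w J e f := by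
          intro f
          rw [mwH_row, hcard, hGH]
          congr 1
          push_cast; linarith
        set X := ∑ f, mwH M d w J e f * x f with hX
        have hX' : ∑ f, x f * mwH M d w J e f = X :=
          Finset.sum_congr rfl fun f _ => mul_comm _ _
        set R := ∑ f, mwH M d w J e f with hR
        have hR0 : 0 ≤ R := Finset.sum_nonneg fun f _ => mwH_nonneg M d w hw J e f
        rcases hR0.eq_or_lt with h0 | hpos
        · have hz0 : ∀ f, mwH M d w J e f = 0 := fun f =>
            (Finset.sum_eq_zero_iff_of_nonneg (fun f _ => mwH_nonneg M d w hw J e f)).1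
              h0.symm f (Finset.mem_univ _)
          have := IH x (by simp [hz0])
          rw [← h0]; simpa using this
        · have h1 := IH (fun f => x f - X / R) (by
            simp only [sub_mul, Finset.sum_sub_distrib, ← Finset.mul_sum]
            rw [hX', ← hR]; field_simp; ring)
          rw [mw_shift _ (mwH_symm M d w _)] at h1
          simp only [hrow'] at h1
          have h2 : ∑ f, x f * ((n + 1) * mwH M d w J e f) = (n + 1) * X := by
            rw [← hX', Finset.mul_sum]
            exact Finset.sum_congr rfl fun f _ => by ring
          rw [h2, ← Finset.mul_sum, ← hR] at h1
          have h3 : 2 * (X / R) * ((n + 1) * X) = 2 * ((n + 1) * (X ^ 2 / R)) := by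
            field_simp
          have h4 : (X / R) ^ 2 * ((n + 1) * R) = (n + 1) * (X ^ 2 / R) := by
            field_simp
          rw [h3, h4] at h1
          linarith
      have hsum : (n + 1) * ∑ f, ∑ g, x f * mwH M d w J f g * x g =
          ∑ e, if e ∈ J then 0 else ∑ f, ∑ g, x f * mwH M d w (insert e J) f g * x g := by
        have : ∀ e, (if e ∈ J then 0 else ∑ f, ∑ g, x f * mwH M d w (insert e J) f g * x g) =
            ∑ f, ∑ g, x f * (if e ∈ J then 0 else mwH M d w (insert e J) f g) * x g := by
          intro e; split_ifs <;> simp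
        simp only [this]
        rw [Finset.mul_sum, Finset.sum_comm]
        refine Finset.sum_congr rfl fun f _ => ?_
        rw [Finset.mul_sum, Finset.sum_comm]
        refine Finset.sum_congr rfl fun g _ => ?_
        rw [← Finset.sum_mul, ← Finset.mul_sum, mwH_sum, ht]
        ring
      have hle : (n + 1) * ∑ f, ∑ g, x f * mwH M d w J f g * x g ≤ (n + 1) *
          ∑ e, (∑ f, mwH M d w J e f * x f) ^ 2 / (∑ f, mwH M d w J e f) := by
        rw [hsum, Finset.mul_sum]
        refine Finset.sum_le_sum fun e _ => ?_
        split_ifs with h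
        · simp [mwH, h]
        · exact hE e h
      exact le_of_mul_le_mul_left hle (by linarith)
    · intro u hu e f he hf
      rw [hrow] at he hf
      refine mwH_conn M d w hw J (by omega) u hu e f ?_ ?_
      · exact pos_of_mul_pos_right he (by linarith)
      · exact pos_of_mul_pos_right hf (by linarith)
    · simp only [hrow]
      calc ∑ e, z e * ((n + 2) * mwG M d w J e) = (n + 2) * ∑ e, z e * mwG M d w J e := by
            rw [Finset.mul_sum]; exact Finset.sum_congr rfl fun e _ => by ring
        _ = 0 := by rw [hz, mul_zero]

end MWaux

section MWfinal

theorem mw_disc (a b c p q : ℝ) (hc : 0 ≤ c) (hp : p ≠ 0)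
    (h : p ^ 2 * c - 2 * p * q * b + q ^ 2 * a ≤ 0) : a * c ≤ b ^ 2 := by
  by_contra hlt
  push Not at hlt
  have hac : 0 < a * c := lt_of_le_of_lt (sq_nonneg b) hlt
  have hc' : 0 < c := by
    rcases hc.eq_or_lt with h0 | h0
    · rw [← h0] at hac; simp at hac
    · exact h0
  have h1 : c * (p ^ 2 * c - 2 * p * q * b + q ^ 2 * a) ≤ 0 := by nlinarith
  have h2 : c * (p ^ 2 * c - 2 * p * q * b + q ^ 2 * a) =
      (p * c - q * b) ^ 2 + q ^ 2 * (a * c - b ^ 2) := by ring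
  have h3 : 0 ≤ q ^ 2 * (a * c - b ^ 2) := mul_nonneg (sq_nonneg _) (by linarith)
  have h4 : q ^ 2 * (a * c - b ^ 2) = 0 := by nlinarith [sq_nonneg (p * c - q * b)]
  have hq : q = 0 := by
    rcases mul_eq_zero.1 h4 with h5 | h5
    · exact pow_eq_zero_iff two_ne_zero |>.1 h5
    · linarith
  rw [h2, hq] at h1
  have : 0 < (p * c) ^ 2 := by positivity
  nlinarith

/-- reverse Cauchy-Schwarz -/
theorem mw_revCS {V : Type*} [Fintype V] (H : V → V → ℝ) (G : V → ℝ)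
    (hs : ∀ e f, H e f = H f e) (hn : ∀ e f, 0 ≤ H e f)
    (h : ∀ z : V → ℝ, ∑ e, z e * G e = 0 → ∑ e, ∑ f, z e * H e f * z f ≤ 0)
    (x y : V → ℝ) (hx : ∀ e, 0 ≤ x e) (hy : ∀ e, 0 ≤ y e) :
    (∑ e, ∑ f, x e * H e f * x f) * (∑ e, ∑ f, y e * H e f * y f) ≤
      (∑ e, ∑ f, x e * H e f * y f) ^ 2 := by
  have hQ : ∀ u v : V → ℝ, (∀ e, 0 ≤ u e) → (∀ e, 0 ≤ v e) →
      0 ≤ ∑ e, ∑ f, u e * H e f * v f := fun u v hu hv =>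
    Finset.sum_nonneg fun e _ => Finset.sum_nonneg fun f _ =>
      mul_nonneg (mul_nonneg (hu e) (hn e f)) (hv f)
  set p := ∑ e, x e * G e with hp
  set q := ∑ e, y e * G e with hq
  by_cases hp0 : p = 0
  · have h1 := h x hp0
    have h2 := hQ y y hy hy
    nlinarith [sq_nonneg (∑ e, ∑ f, x e * H e f * y f)]
  · refine mw_disc _ _ _ p q (hQ y y hy hy) hp0 ?_
    have h1 := h (fun e => p * y e - q * x e) (by
      simp only [sub_mul, Finset.sum_sub_distrib, mul_assoc, ← Finset.mul_sum]
      rw [← hp, ← hq]; ring)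
    have h2 : ∑ e, ∑ f, y e * H e f * x f = ∑ e, ∑ f, x e * H e f * y f := by
      rw [Finset.sum_comm]
      exact Finset.sum_congr rfl fun e _ => Finset.sum_congr rfl fun f _ => by rw [hs]; ring
    refine le_trans (le_of_eq ?_) h1
    have h3 : 2 * p * q * ∑ e, ∑ f, x e * H e f * y f =
        p * q * ∑ e, ∑ f, x e * H e f * y f + p * q * ∑ e, ∑ f, y e * H e f * x f := by
      rw [h2]; ring
    rw [h3]
    simp only [Finset.mul_sum, ← Finset.sum_add_distrib, ← Finset.sum_sub_distrib]
    exact Finset.sum_congr rfl fun e _ => Finset.sum_congr rfl fun f _ => by ring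

open Classical in
theorem mwH_quad {V : Type*} [Fintype V] [DecidableEq V] (M : FinMatroid V) (d : ℕ) (w : V → ℝ)
    (x y : V → ℝ) : ∑ e, ∑ f, x e * mwH M d w ∅ e f * y f =
    ∑ B : Finset V, if M.Indep B ∧ B.card = d then
      (∏ e ∈ B, w e) * ((∑ e ∈ B, x e) * (∑ e ∈ B, y e) - ∑ e ∈ B, x e * y e) else 0 := by
  have h1 : ∀ e f, x e * mwH M d w ∅ e f * y f = ∑ B : Finset V, if M.Indep B ∧ B.card = d then
      (∏ e ∈ B, w e) * ((if e ∈ B then x e else 0) * (if f ∈ B then y f else 0) -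
        if f = e then (if e ∈ B then x e * y e else 0) else 0) else 0 := by
    intro e f
    unfold mwH mwG mwF
    by_cases hef : f = e
    · subst hef
      simp only [Finset.notMem_empty, if_false, Finset.mem_insert_self, if_true, mul_zero, zero_mul]
      symm
      refine Finset.sum_eq_zero fun B _ => ?_
      by_cases h : f ∈ B <;> simp [h]
    · simp only [Finset.notMem_empty, if_false, Finset.mem_insert, hef, or_self, Finset.mul_sum,
        Finset.sum_mul]
      refine Finset.sum_congr rfl fun B _ => ?_
      by_cases h1 : M.Indep B <;> by_cases h2 : B.card = d <;> by_cases h3 : e ∈ B <;>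
        by_cases h4 : f ∈ B <;> simp [h1, h2, h3, h4, Finset.insert_subset_iff]
      ring
  simp only [h1]
  have h2 : ∀ e, (∑ f, ∑ B : Finset V, if M.Indep B ∧ B.card = d then
      (∏ e ∈ B, w e) * ((if e ∈ B then x e else 0) * (if f ∈ B then y f else 0) -
        if f = e then (if e ∈ B then x e * y e else 0) else 0) else 0) =
      ∑ B : Finset V, if M.Indep B ∧ B.card = d then
      (∏ e ∈ B, w e) * ((if e ∈ B then x e else 0) * (∑ f ∈ B, y f) -
        (if e ∈ B then x e * y e else 0)) else 0 := by
    intro e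
    rw [Finset.sum_comm]
    refine Finset.sum_congr rfl fun B _ => ?_
    split_ifs
    all_goals simp [← Finset.mul_sum, Finset.sum_sub_distrib]
  simp only [h2]
  rw [Finset.sum_comm]
  refine Finset.sum_congr rfl fun B _ => ?_
  split_ifs
  · rw [← Finset.mul_sum, Finset.sum_sub_distrib, ← Finset.sum_mul]
    simp
  · simp

variable {E : Type*} [Fintype E] [DecidableEq E]

/-- direct sum with a free matroid -/
def mwSum (M : FinMatroid E) (m : ℕ) : FinMatroid (E ⊕ Fin m) where
  Indep B := M.Indep B.toLeft
  indep_empty := M.indep_subset M.indep_empty (by intro e he; simp at he)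
  indep_subset I J hJ hIJ := M.indep_subset hJ (Finset.toLeft_subset_toLeft hIJ)
  indep_exchange I J hI hJ h := by
    by_cases hR : J.toRight ⊆ I.toRight
    · have h1 := Finset.card_le_card hR
      have h2 := Finset.card_toLeft_add_card_toRight (u := I)
      have h3 := Finset.card_toLeft_add_card_toRight (u := J)
      obtain ⟨e, he, heI, hi⟩ := M.indep_exchange hI hJ (by omega)
      refine ⟨Sum.inl e, by simpa using he, by simpa using heI, ?_⟩
      simpa using hi
    · obtain ⟨e, he, heI⟩ := Finset.not_subset.1 hR
      refine ⟨Sum.inr e, by simpa using he, by simpa using heI, ?_⟩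
      simpa using hI

open Classical in
theorem mw_group (M : FinMatroid E) (m d : ℕ) (h : ℕ → ℝ) :
    (∑ B : Finset (E ⊕ Fin m), if (mwSum M m).Indep B ∧ B.card = d then h B.toRight.card else 0) =
    ∑ s ∈ Finset.range (d + 1), h s * ((m.choose s : ℝ) * (M.numIndep (d - s) : ℝ)) := by
  rw [← Finset.sum_filter]
  have hmap : ∀ B ∈ (Finset.univ.filter fun B : Finset (E ⊕ Fin m) =>
      (mwSum M m).Indep B ∧ B.card = d), B.toRight.card ∈ Finset.range (d + 1) := by
    intro B hB
    simp only [Finset.mem_filter, Finset.mem_univ, true_and] at hB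
    have := Finset.card_toLeft_add_card_toRight (u := B)
    simp only [Finset.mem_range]; omega
  rw [← Finset.sum_fiberwise_of_maps_to hmap]
  refine Finset.sum_congr rfl fun s hs => ?_
  rw [Finset.mem_range] at hs
  rw [Finset.sum_congr rfl (g := fun _ => h s) (fun B hB => by
    rw [(Finset.mem_filter.1 hB).2])]
  rw [Finset.sum_const, nsmul_eq_mul, mul_comm]
  congr 1
  rw [mul_comm, ← Nat.cast_mul]
  congr 1
  unfold FinMatroid.numIndep
  rw [show m.choose s = (Finset.powersetCard s (Finset.univ : Finset (Fin m))).card by simp,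
    ← Finset.card_product]
  refine Finset.card_bij' (fun B _ => (B.toLeft, B.toRight)) (fun P _ => P.1.disjSum P.2) ?_ ?_ ?_ ?_
  · intro B hB
    simp only [Finset.mem_filter, Finset.mem_univ, true_and] at hB
    have := Finset.card_toLeft_add_card_toRight (u := B)
    simp only [Finset.mem_product, Finset.mem_filter, Finset.mem_univ, true_and,
      Finset.mem_powersetCard, Finset.subset_univ]
    exact ⟨⟨hB.1.1, by omega⟩, hB.2⟩
  · intro P hP
    simp only [Finset.mem_product, Finset.mem_filter, Finset.mem_univ, true_and,
      Finset.mem_powersetCard, Finset.subset_univ] at hP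
    refine Finset.mem_filter.2 ⟨Finset.mem_filter.2 ⟨Finset.mem_univ _, ?_, ?_⟩, ?_⟩
    · change M.Indep (P.1.disjSum P.2).toLeft
      rw [Finset.toLeft_disjSum]; exact hP.1.1
    · rw [Finset.card_disjSum]; omega
    · rw [Finset.toRight_disjSum]; exact hP.2
  · intro B _; exact Finset.toLeft_disjSum_toRight
  · intro P _; simp

theorem mw_eps (M : FinMatroid E) (m d : ℕ) (hd : 2 ≤ d) (ε : ℝ) (hε : 0 < ε) :
    (∑ s ∈ Finset.range (d + 1), ε ^ s * ((s : ℝ) * s - s) *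
      ((m.choose s : ℝ) * (M.numIndep (d - s) : ℝ))) *
    (∑ s ∈ Finset.range (d + 1), ε ^ s * (((d : ℝ) - s) * (d - s) - (d - s)) *
      ((m.choose s : ℝ) * (M.numIndep (d - s) : ℝ))) ≤
    (∑ s ∈ Finset.range (d + 1), ε ^ s * ((s : ℝ) * (d - s)) *
      ((m.choose s : ℝ) * (M.numIndep (d - s) : ℝ))) ^ 2 := by
  classical
  let w : E ⊕ Fin m → ℝ := Sum.elim (fun _ => 1) (fun _ => ε)
  have hw : ∀ e, 0 < w e := by
    rintro (e | e)
    · exact one_pos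
    · exact hε
  let x : E ⊕ Fin m → ℝ := Sum.elim (fun _ => 0) (fun _ => 1)
  let y : E ⊕ Fin m → ℝ := Sum.elim (fun _ => 1) (fun _ => 0)
  have hx : ∀ e, 0 ≤ x e := by rintro (e | e) <;> simp [x]
  have hy : ∀ e, 0 ≤ y e := by rintro (e | e) <;> simp [y]
  have key := mw_revCS (mwH (mwSum M m) d w ∅) (mwG (mwSum M m) d w ∅)
    (mwH_symm _ d w ∅) (mwH_nonneg _ d w hw ∅)
    (mw_main (mwSum M m) d w hw (d - 2) ∅ (by simp; omega)) x y hx hy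
  have hsum : ∀ (B : Finset (E ⊕ Fin m)) (g : E ⊕ Fin m → ℝ),
      ∑ e ∈ B, g e = ∑ e ∈ B.toLeft, g (Sum.inl e) + ∑ e ∈ B.toRight, g (Sum.inr e) := by
    intro B g
    conv_lhs => rw [← Finset.toLeft_disjSum_toRight (u := B)]
    rw [Finset.sum_disjSum]
  have hprod : ∀ (B : Finset (E ⊕ Fin m)), ∏ e ∈ B, w e = ε ^ B.toRight.card := by
    intro B
    conv_lhs => rw [← Finset.toLeft_disjSum_toRight (u := B)]
    rw [Finset.prod_disjSum]
    simp [w]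
  have conv : ∀ (u v : E ⊕ Fin m → ℝ) (g : ℕ → ℝ),
      (∀ B : Finset (E ⊕ Fin m), B.card = d →
        (∑ e ∈ B, u e) * (∑ e ∈ B, v e) - ∑ e ∈ B, u e * v e = g B.toRight.card) →
      ∑ e, ∑ f, u e * mwH (mwSum M m) d w ∅ e f * v f =
      ∑ s ∈ Finset.range (d + 1), ε ^ s * g s *
        ((m.choose s : ℝ) * (M.numIndep (d - s) : ℝ)) := by
    intro u v g hg
    rw [mwH_quad, ← mw_group M m d (fun s => ε ^ s * g s)]
    refine Finset.sum_congr rfl fun B _ => ?_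
    split_ifs with h
    · rw [hg B h.2, hprod]
    · rfl
  have hl : ∀ B : Finset (E ⊕ Fin m), B.card = d → (B.toLeft.card : ℝ) = d - B.toRight.card := by
    intro B hB
    rw [← hB, ← Finset.card_toLeft_add_card_toRight (u := B)]; push_cast; ring
  rw [conv x x (fun s => (s : ℝ) * s - s) (fun B hB => by simp [hsum, x]),
    conv y y (fun s => ((d : ℝ) - s) * (d - s) - (d - s)) (fun B hB => by simp [hsum, y, hl B hB]),
    conv x y (fun s => (s : ℝ) * (d - s)) (fun B hB => by simp [hsum, x, y, hl B hB])] at key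
  exact key

theorem mw_logconc (M : FinMatroid E) (k : ℕ) :
    M.numIndep k * M.numIndep (k + 2) ≤ M.numIndep (k + 1) ^ 2 := by
  let d := k + 2
  let a : ℕ → ℝ := fun s => (d.choose s : ℝ) * (M.numIndep (d - s) : ℝ)
  let A : ℝ → ℝ := fun ε => ∑ s ∈ Finset.range (k + 1),
    ε ^ s * (((s + 2 : ℕ) : ℝ) * (s + 2 : ℕ) - (s + 2 : ℕ)) * a (s + 2)
  let B : ℝ → ℝ := fun ε => ∑ s ∈ Finset.range (k + 2),
    ε ^ s * (((s + 1 : ℕ) : ℝ) * (d - (s + 1 : ℕ))) * a (s + 1)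
  let C : ℝ → ℝ := fun ε => ∑ s ∈ Finset.range (k + 3),
    ε ^ s * (((d : ℝ) - s) * (d - s) - (d - s)) * a s
  have hAC : ∀ ε : ℝ, 0 < ε → A ε * C ε ≤ B ε ^ 2 := by
    intro ε hε
    have key := mw_eps M d d (by simp [d]) ε hε
    have h1 : ∑ s ∈ Finset.range (d + 1), ε ^ s * ((s : ℝ) * s - s) *
        ((d.choose s : ℝ) * (M.numIndep (d - s) : ℝ)) = ε ^ 2 * A ε := by
      rw [show d + 1 = k + 1 + 1 + 1 from rfl, Finset.sum_range_succ', Finset.sum_range_succ',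
        Finset.mul_sum]
      simp only [Nat.cast_zero, Nat.cast_one, zero_add, mul_zero, sub_self, zero_mul, add_zero,
        mul_one]
      refine Finset.sum_congr rfl fun s _ => ?_
      rw [pow_add, pow_add]
      simp only [a]
      ring
    have h2 : ∑ s ∈ Finset.range (d + 1), ε ^ s * ((s : ℝ) * (d - s)) *
        ((d.choose s : ℝ) * (M.numIndep (d - s) : ℝ)) = ε * B ε := by
      rw [show d + 1 = k + 2 + 1 from rfl, Finset.sum_range_succ', Finset.mul_sum]
      simp only [Nat.cast_zero, mul_zero, zero_mul, add_zero]
      refine Finset.sum_congr rfl fun s _ => ?_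
      rw [pow_succ]
      simp only [a]
      ring
    rw [h1, h2] at key
    change ε ^ 2 * A ε * C ε ≤ _ at key
    have hpos : 0 < ε ^ 2 := by positivity
    refine le_of_mul_le_mul_left ?_ hpos
    calc ε ^ 2 * (A ε * C ε) = ε ^ 2 * A ε * C ε := by ring
      _ ≤ _ := key
      _ = _ := by ring
  have hA : Continuous A := by simp only [A]; fun_prop
  have hB : Continuous B := by simp only [B]; fun_prop
  have hC : Continuous C := by simp only [C]; fun_prop
  have h0 : A 0 * C 0 ≤ B 0 ^ 2 := by
    have t1 : Filter.Tendsto (fun ε => A ε * C ε) (nhdsWithin 0 (Set.Ioi 0)) (nhds (A 0 * C 0)) :=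
      ((hA.mul hC).tendsto 0).mono_left nhdsWithin_le_nhds
    have t2 : Filter.Tendsto (fun ε => B ε ^ 2) (nhdsWithin 0 (Set.Ioi 0)) (nhds (B 0 ^ 2)) :=
      ((hB.pow 2).tendsto 0).mono_left nhdsWithin_le_nhds
    refine le_of_tendsto_of_tendsto t1 t2 ?_
    filter_upwards [self_mem_nhdsWithin] with ε hε
    exact hAC ε hε
  have hA0 : A 0 = 2 * a 2 := by
    simp only [A]
    rw [Finset.sum_range_succ', Finset.sum_eq_zero (fun s _ => by simp)]
    norm_num
  have hB0 : B 0 = (k + 1) * a 1 := by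
    simp only [B]
    rw [Finset.sum_range_succ', Finset.sum_eq_zero (fun s _ => by simp)]
    simp only [d]; push_cast; ring
  have hC0 : C 0 = (k + 2) * (k + 1) * a 0 := by
    simp only [C]
    rw [Finset.sum_range_succ', Finset.sum_eq_zero (fun s _ => by simp)]
    simp only [d]; push_cast; ring
  have ha0 : a 0 = M.numIndep (k + 2) := by simp [a, d]
  have ha1 : a 1 = (k + 2) * M.numIndep (k + 1) := by simp [a, d]
  have ha2 : 2 * a 2 = (k + 2) * (k + 1) * M.numIndep k := by
    simp only [a, d, Nat.cast_choose_two]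
    push_cast
    ring
  rw [hA0, hB0, hC0, ha0, ha1, ha2] at h0
  have hpos : (0:ℝ) < ((k + 2) * (k + 1)) ^ 2 := by positivity
  have h1 : (M.numIndep k : ℝ) * M.numIndep (k + 2) ≤ (M.numIndep (k + 1) : ℝ) ^ 2 := by
    refine le_of_mul_le_mul_left ?_ hpos
    calc _ = _ := by ring
      _ ≤ _ := h0
      _ = _ := by ring
  exact_mod_cast h1

theorem mw_pos (M : FinMatroid E) (k : ℕ) (hk : k ≤ M.rk) : 0 < M.numIndep k := by
  classical
  unfold FinMatroid.rk FinMatroid.rank at hk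
  have hne : ((Finset.univ : Finset E).powerset.filter fun I => M.Indep I).Nonempty :=
    ⟨∅, by simp [M.indep_empty]⟩
  obtain ⟨B, hB, hBc⟩ := Finset.exists_mem_eq_sup _ hne Finset.card
  have hBi : M.Indep B := by simpa using hB
  have hk' : k ≤ B.card := by
    rw [← hBc]; convert hk
  obtain ⟨I, hIB, hI⟩ := Finset.exists_subset_card_eq hk'
  unfold FinMatroid.numIndep
  refine Finset.card_pos.2 ⟨I, ?_⟩
  simp only [Finset.mem_filter, Finset.mem_univ, true_and]
  exact ⟨M.indep_subset hBi hIB, hI⟩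

theorem mw_unimodal (f : ℕ → ℕ) (r : ℕ) (hpos : ∀ k ≤ r, 0 < f k)
    (hlc : ∀ k, f k * f (k + 2) ≤ f (k + 1) ^ 2) :
    ∃ i ≤ r, (∀ j k, j ≤ k → k ≤ i → f j ≤ f k) ∧
      (∀ j k, i ≤ j → j ≤ k → k ≤ r → f k ≤ f j) := by
  -- once decreasing, stays decreasing
  have hdec : ∀ j, f (j + 1) < f j → ∀ n, j + n + 1 ≤ r → f (j + n + 1) ≤ f (j + n) := by
    intro j hj n
    induction n with
    | zero => intro _; exact hj.le
    | succ n ih =>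
      intro hn
      have h1 := ih (by omega)
      have h2 := hlc (j + n)
      have h3 := hpos (j + n + 1) (by omega)
      change f (j + n + 1 + 1) ≤ f (j + n + 1)
      by_contra h
      push Not at h
      have h4 : f (j + n + 1) * f (j + n + 1) < f (j + n + 1) * f (j + n + 2) :=
        Nat.mul_lt_mul_of_pos_left h h3
      have h5 : f (j + n + 1) * f (j + n + 2) ≤ f (j + n) * f (j + n + 2) :=
        Nat.mul_le_mul_right _ h1
      rw [sq] at h2
      omega
  by_cases hex : ∃ j, j < r ∧ f (j + 1) < f j
  · classical
    have hs := Nat.find_spec hex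
    have hm := fun {m} => Nat.find_min (m := m) hex
    generalize Nat.find hex = i at hs hm
    refine ⟨i, hs.1.le, ?_, ?_⟩
    · intro j k hjk
      induction k, hjk using Nat.le_induction with
      | base => intro _; exact le_rfl
      | succ k hk ih =>
        intro hki
        refine (ih (by omega)).trans ?_
        have := hm (m := k) (by omega)
        by_contra hc
        exact this ⟨by omega, by omega⟩
    · intro j k hij hjk
      induction k, hjk using Nat.le_induction with
      | base => intro _; exact le_rfl
      | succ k hk ih =>
        intro hkr
        refine le_trans ?_ (ih (by omega))
        have := hdec i hs.2 (k - i) (by omega)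
        rwa [show i + (k - i) = k by omega] at this
  · push Not at hex
    refine ⟨r, le_rfl, ?_, ?_⟩
    · intro j k hjk
      induction k, hjk using Nat.le_induction with
      | base => intro _; exact le_rfl
      | succ k hk ih =>
        intro hki
        exact (ih (by omega)).trans (hex k (by omega))
    · intro j k h1 h2 h3
      rw [show j = k by omega]

end MWfinal

open FinMatroid in
/-- **Mason–Welsh conjecture (proved by Adiprasito–Huh–Katz).** The number `f_k(M)` of
independent sets of cardinality `k` of a rank-`r` matroid `M` forms a log-concave, hence
unimodal, sequence `f_0(M), …, f_r(M)`. -/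
theorem mason_welsh {E : Type*} [Fintype E] [DecidableEq E]
    (M : FinMatroid E) (r : ℕ) (hr : M.rk = r) :
    (∀ k, 0 < k → k < r →
      M.numIndep (k - 1) * M.numIndep (k + 1) ≤ M.numIndep k ^ 2) ∧
    (∃ i ≤ r, (∀ j k, j ≤ k → k ≤ i → M.numIndep j ≤ M.numIndep k) ∧
      (∀ j k, i ≤ j → j ≤ k → k ≤ r → M.numIndep k ≤ M.numIndep j)) := by
  refine ⟨?_, mw_unimodal M.numIndep r (fun k hk => mw_pos M k (hr ▸ hk)) (mw_logconc M)⟩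
  intro k hk _
  obtain ⟨k, rfl⟩ : ∃ j, k = j + 1 := ⟨k - 1, by omega⟩
  exact mw_logconc M k
end
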